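/- (Weak spectral gap on the complement of the degenerate subspace.) There exists a constant $\gamma > 0$ such that for every $\theta \in [-\pi,\pi)^3$ and every continuously differentiable $\mathbb{Z}^3$-periodic $w : \mathbb{R}^3 \to \mathbb{C}$ satisfying the orthogonality conditions (i) $\int_{\square} w\,\mathrm{d}y = 0$ and (ii) $\int_{B\times[-1/2,1/2)} \big( \nabla' w(y) \cdot \overline{\nabla' \zeta(y_1,y_2)} + w(y)\,\overline{\zeta(y_1,y_2)} \big)\,\mathrm{d}y = 0$ for every smooth compactly supported $\zeta : B \to \mathbb{C}$, one has $a_\theta[w] \ge \gamma \int_{\square} |w|^2\,\mathrm{d}y$. -/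

import Mathlib

open MeasureTheory
open scoped Classical

/-- The partial derivative `∂_j f` of a function `f : ℝ³ → ℂ`. -/
noncomputable def pd3 (f : (Fin 3 → ℝ) → ℂ) (j : Fin 3) (x : Fin 3 → ℝ) : ℂ :=
  fderiv ℝ f x (Pi.single j 1)

/-- The partial derivative `∂_j f` of a function `f : ℝ² → ℂ`. -/
noncomputable def pd2 (f : (Fin 2 → ℝ) → ℂ) (j : Fin 2) (x : Fin 2 → ℝ) : ℂ :=
  fderiv ℝ f x (Pi.single j 1)

/-- The dual cell `□* = [-π,π)³`. -/
noncomputable def dualCell : Set (Fin 3 → ℝ) :=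
  Set.univ.pi fun _ => Set.Ico (-Real.pi) Real.pi

/-- The periodic reference cell `□ = [-1/2,1/2)³`. -/
noncomputable def cell : Set (Fin 3 → ℝ) :=
  Set.univ.pi fun _ => Set.Ico (-(1 : ℝ) / 2) (1 / 2)

/-- The periodically extended fibre set `⋃_{m' ∈ ℤ²} (B + m') × ℝ`, where `B` is the open
disk of radius `r` centred at the origin. -/
def fiberSet (r : ℝ) : Set (Fin 3 → ℝ) :=
  {y | ∃ m : Fin 2 → ℤ, (y 0 - (m 0 : ℝ)) ^ 2 + (y 1 - (m 1 : ℝ)) ^ 2 < r ^ 2}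

/-- The open disk `B ⊂ ℝ²` of radius `r` centred at the origin. -/
def Bset (r : ℝ) : Set (Fin 2 → ℝ) :=
  {y' | (y' 0) ^ 2 + (y' 1) ^ 2 < r ^ 2}

/-- The set `B × [-1/2,1/2) ⊂ ℝ³`. -/
def fiberCell (r : ℝ) : Set (Fin 3 → ℝ) :=
  {y | (y 0) ^ 2 + (y 1) ^ 2 < r ^ 2 ∧ y 2 ∈ Set.Ico (-(1 : ℝ) / 2) (1 / 2)}

/-- Projection of `y ∈ ℝ³` onto its first two coordinates `y' = (y₁,y₂)`. -/
def low (y : Fin 3 → ℝ) : Fin 2 → ℝ := fun i => y i.castSucc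

/-- The quadratic form `a_θ[w] = ∫_{□∖F} |∇w + iθw|² dy + ∫_{□∩F} a(y₃)|∂₃w + iθ₃w|² dy`. -/
noncomputable def aForm (a : ℝ → ℝ) (r : ℝ) (θ : Fin 3 → ℝ) (w : (Fin 3 → ℝ) → ℂ) : ℝ :=
  ∫ y in cell,
    if y ∈ fiberSet r then
      a (y 2) * ‖pd3 w 2 y + Complex.I * (θ 2 : ℂ) * w y‖ ^ 2
    else
      ∑ j, ‖pd3 w j y + Complex.I * (θ j : ℂ) * w y‖ ^ 2

theorem norm_integral_sq_le {α F : Type*} [MeasurableSpace α] [NormedAddCommGroup F]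
    [NormedSpace ℝ F] {μ : Measure α} [IsFiniteMeasure μ] (hμ : μ.real Set.univ ≤ 1)
    {f : α → F} (hf : Integrable f μ) (hf2 : Integrable (fun x => ‖f x‖ ^ 2) μ) :
    ‖∫ x, f x ∂μ‖ ^ 2 ≤ ∫ x, ‖f x‖ ^ 2 ∂μ := by
  set m := ∫ x, ‖f x‖ ∂μ with hm
  have h1 : ‖∫ x, f x ∂μ‖ ≤ m := norm_integral_le_integral_norm _
  have h2 : 0 ≤ ∫ x, (‖f x‖ - m) ^ 2 ∂μ := integral_nonneg fun _ => sq_nonneg _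
  have h3 : ∫ x, (‖f x‖ - m) ^ 2 ∂μ
      = ∫ x, ‖f x‖ ^ 2 ∂μ - 2 * m * m + m ^ 2 * μ.real Set.univ := by
    have : ∀ x, (‖f x‖ - m) ^ 2 = ‖f x‖ ^ 2 - 2 * m * ‖f x‖ + m ^ 2 := fun x => by ring
    simp_rw [this]
    have hA : Integrable (fun x => ‖f x‖ ^ 2 - 2 * m * ‖f x‖) μ := hf2.sub (hf.norm.const_mul _)
    rw [integral_add hA (integrable_const _),
      integral_sub hf2 (hf.norm.const_mul _), integral_const_mul, ← hm, integral_const,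
      smul_eq_mul]
    ring
  have h4 : ‖∫ x, f x ∂μ‖ ^ 2 ≤ m ^ 2 := by gcongr
  nlinarith [mul_le_mul_of_nonneg_left hμ (sq_nonneg m)]

section line

variable {f f' : ℝ → ℂ} {θ : ℝ}

theorem continuous_twisted_sq (hf : ∀ s, HasDerivAt f (f' s) s) (hc : Continuous f') :
    Continuous fun u => ‖f' u + Complex.I * (θ : ℂ) * f u‖ ^ 2 := by
  have : Continuous f := continuous_iff_continuousAt.2 fun s => (hf s).continuousAt
  fun_prop

theorem phase_sub_sq_le (hf : ∀ s, HasDerivAt f (f' s) s) (hc : Continuous f') {s t : ℝ}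
    (hst : |s - t| ≤ 1) :
    ‖Complex.exp (Complex.I * (θ * s : ℝ)) * f s - Complex.exp (Complex.I * (θ * t : ℝ)) * f t‖ ^ 2
      ≤ ∫ u in Set.uIoc s t, ‖f' u + Complex.I * (θ : ℂ) * f u‖ ^ 2 := by
  have hfc : Continuous f := continuous_iff_continuousAt.2 fun s => (hf s).continuousAt
  have hU : ∀ u : ℝ, HasDerivAt (fun u : ℝ => Complex.exp (Complex.I * (θ * u : ℝ)) * f u)
      (Complex.exp (Complex.I * (θ * u : ℝ)) * (f' u + Complex.I * (θ : ℂ) * f u)) u := by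
    intro u
    have h1 : HasDerivAt (fun u : ℝ => Complex.I * ((θ * u : ℝ) : ℂ)) (Complex.I * (θ : ℂ)) u := by
      have := ((hasDerivAt_id u).const_mul θ).ofReal_comp.const_mul Complex.I
      simpa using this
    refine (h1.cexp.mul (hf u)).congr_deriv ?_
    ring
  have hcont : Continuous fun u : ℝ =>
      Complex.exp (Complex.I * (θ * u : ℝ)) * (f' u + Complex.I * (θ : ℂ) * f u) := by fun_prop
  have hn : ∀ u : ℝ, ‖Complex.exp (Complex.I * (θ * u : ℝ)) *
      (f' u + Complex.I * (θ : ℂ) * f u)‖ = ‖f' u + Complex.I * (θ : ℂ) * f u‖ := by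
    intro u
    rw [norm_mul, Complex.norm_exp_I_mul_ofReal, one_mul]
  rw [← intervalIntegral.integral_eq_sub_of_hasDerivAt (fun u _ => hU u)
    (hcont.intervalIntegrable _ _), intervalIntegral.norm_intervalIntegral_eq, Set.uIoc_comm]
  have hvol : (volume.restrict (Set.uIoc s t)).real Set.univ ≤ 1 := by
    rw [measureReal_restrict_apply_univ, Set.uIoc, Real.volume_real_Ioc]
    rw [max_sub_min_eq_abs, abs_sub_comm]
    simpa using hst
  have hsub : Set.uIoc s t ⊆ Set.uIcc s t := Set.uIoc_subset_uIcc
  have : IsFiniteMeasure (volume.restrict (Set.uIoc s t)) := by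
    unfold Set.uIoc; infer_instance
  refine (norm_integral_sq_le hvol (hcont.integrableOn_uIoc) ?_).trans (le_of_eq ?_)
  · exact Continuous.integrableOn_uIoc (by fun_prop)
  · simp_rw [hn]

theorem norm_sub_sq_le (hf : ∀ s, HasDerivAt f (f' s) s) (hc : Continuous f') {s t : ℝ}
    (hst : |s - t| ≤ 1) :
    ‖f s - f t‖ ^ 2 ≤ 2 * (∫ u in Set.uIoc s t, ‖f' u + Complex.I * (θ : ℂ) * f u‖ ^ 2)
      + 2 * (θ ^ 2 * ‖f t‖ ^ 2) := by
  have h := phase_sub_sq_le (θ := θ) hf hc hst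
  set e := Complex.exp (Complex.I * (θ * s : ℝ)) with he
  have hen : ‖e‖ = 1 := Complex.norm_exp_I_mul_ofReal _
  have h1 : Complex.exp (Complex.I * (θ * t : ℝ))
      = e * Complex.exp (Complex.I * (θ * (t - s) : ℝ)) := by
    rw [he, ← Complex.exp_add]; congr 1; push_cast; ring
  have h2 : ‖Complex.exp (Complex.I * (θ * (t - s) : ℝ)) - 1‖ ≤ |θ| := by
    refine Real.norm_exp_I_mul_ofReal_sub_one_le.trans ?_
    rw [Real.norm_eq_abs, abs_mul, abs_sub_comm]
    exact mul_le_of_le_one_right (abs_nonneg _) hst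
  rw [h1] at h
  set d := Complex.exp (Complex.I * (θ * (t - s) : ℝ)) with hd
  have h3 : ‖e * f s - e * d * f t‖ = ‖f s - d * f t‖ := by
    rw [mul_assoc, ← mul_sub, norm_mul, hen, one_mul]
  rw [h3] at h
  have h4 : ‖f s - f t‖ ≤ ‖f s - d * f t‖ + |θ| * ‖f t‖ := by
    calc ‖f s - f t‖ = ‖(f s - d * f t) + (d - 1) * f t‖ := by congr 1; ring
      _ ≤ _ := (norm_add_le _ _).trans (by rw [norm_mul]; gcongr)
  have h5 : ‖f s - f t‖ ^ 2 ≤ (‖f s - d * f t‖ + |θ| * ‖f t‖) ^ 2 := by gcongr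
  have h6 : (|θ| * ‖f t‖) ^ 2 = θ ^ 2 * ‖f t‖ ^ 2 := by rw [mul_pow, sq_abs]
  nlinarith [sq_nonneg (‖f s - d * f t‖ - |θ| * ‖f t‖)]

theorem sq_mul_norm_sq_le_of_periodic (hf : ∀ s, HasDerivAt f (f' s) s) (hc : Continuous f')
    (hp : Function.Periodic f 1) (hp' : Function.Periodic f' 1) (hθ : |θ| ≤ Real.pi) (t : ℝ) :
    θ ^ 2 * ‖f t‖ ^ 2 ≤ 4 * ∫ u in (0 : ℝ)..1, ‖f' u + Complex.I * (θ : ℂ) * f u‖ ^ 2 := by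
  have h := phase_sub_sq_le (θ := θ) (s := t) (t := t + 1) hf hc (by simp)
  have hper : Function.Periodic (fun u => ‖f' u + Complex.I * (θ : ℂ) * f u‖ ^ 2) 1 := by
    intro u; simp only [hp u, hp' u]
  rw [Set.uIoc_of_le (by linarith), ← intervalIntegral.integral_of_le (by linarith),
    hper.intervalIntegral_add_eq t 0, zero_add, hp t] at h
  have h1 : Complex.exp (Complex.I * (θ * (t + 1) : ℝ))
      = Complex.exp (Complex.I * (θ * t : ℝ)) * Complex.exp (Complex.I * (θ : ℝ)) := by
    rw [← Complex.exp_add]; congr 1; push_cast; ring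
  have h2 : ‖Complex.exp (Complex.I * (θ * t : ℝ)) * f t -
      Complex.exp (Complex.I * (θ * (t + 1) : ℝ)) * f t‖
      = ‖Complex.exp (Complex.I * (θ : ℝ)) - 1‖ * ‖f t‖ := by
    rw [h1, ← sub_mul, ← mul_one_sub, norm_mul, norm_mul, Complex.norm_exp_I_mul_ofReal, one_mul,
      norm_sub_rev]
  rw [h2, Complex.norm_exp_I_mul_ofReal_sub_one] at h
  have h3 : |θ| ≤ 2 * ‖2 * Real.sin (θ / 2)‖ := by
    have hs := Real.mul_le_sin (x := |θ| / 2) (by positivity) (by linarith)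
    have habs : |Real.sin (θ / 2)| = Real.sin (|θ| / 2) := by
      rw [show |θ| / 2 = |θ / 2| by rw [abs_div, abs_two]]
      rw [Real.abs_sin_eq_sin_abs_of_abs_le_pi]
      rw [abs_div, abs_two]; linarith [abs_nonneg θ]
    rw [Real.norm_eq_abs, abs_mul, abs_two, habs]
    have hpi : 1 / 2 ≤ 2 / Real.pi := by
      rw [div_le_div_iff₀ (by norm_num) Real.pi_pos]; linarith [Real.pi_le_four]
    nlinarith [abs_nonneg θ]
  have h4 : θ ^ 2 * ‖f t‖ ^ 2 = (|θ| * ‖f t‖) ^ 2 := by rw [mul_pow, sq_abs]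
  rw [h4]
  calc (|θ| * ‖f t‖) ^ 2 ≤ (2 * ‖2 * Real.sin (θ / 2)‖ * ‖f t‖) ^ 2 := by gcongr
    _ = 4 * (‖2 * Real.sin (θ / 2)‖ * ‖f t‖) ^ 2 := by ring
    _ ≤ _ := by linarith

theorem norm_sub_sq_le_of_periodic (hf : ∀ s, HasDerivAt f (f' s) s) (hc : Continuous f')
    (hp : Function.Periodic f 1) (hp' : Function.Periodic f' 1) (hθ : |θ| ≤ Real.pi) {s t : ℝ}
    (hst : |s - t| ≤ 1) :
    ‖f s - f t‖ ^ 2 ≤ 10 * ∫ u in (0 : ℝ)..1, ‖f' u + Complex.I * (θ : ℂ) * f u‖ ^ 2 := by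
  have h1 := norm_sub_sq_le (θ := θ) hf hc hst
  have h2 := sq_mul_norm_sq_le_of_periodic hf hc hp hp' hθ t
  have hper : Function.Periodic (fun u => ‖f' u + Complex.I * (θ : ℂ) * f u‖ ^ 2) 1 := by
    intro u; simp only [hp u, hp' u]
  have h3 : (∫ u in Set.uIoc s t, ‖f' u + Complex.I * (θ : ℂ) * f u‖ ^ 2)
      ≤ ∫ u in (0 : ℝ)..1, ‖f' u + Complex.I * (θ : ℂ) * f u‖ ^ 2 := by
    have := hper.intervalIntegral_add_eq 0 (min s t)
    rw [zero_add] at this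
    rw [this, intervalIntegral.integral_of_le (by linarith)]
    refine setIntegral_mono_set
      (Continuous.integrableOn_Ioc (continuous_twisted_sq hf hc))
      (Filter.Eventually.of_forall fun _ => by positivity)
      (LE.le.eventuallyLE ?_)
    refine Set.Ioc_subset_Ioc_right ?_
    have := max_sub_min_eq_abs s t
    rw [abs_sub_comm] at this
    linarith
  linarith

end line

theorem hasDerivAt_line0 {W : (Fin 2 → ℝ) → ℂ} (hW : ContDiff ℝ 1 W) (y s : ℝ) :
    HasDerivAt (fun s => W ![s, y]) (pd2 W 0 ![s, y]) s := by
  have h1 : HasDerivAt (fun s : ℝ => (![s, y] : Fin 2 → ℝ)) (Pi.single 0 1) s := by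
    rw [hasDerivAt_pi]
    intro i
    fin_cases i
    · simpa using hasDerivAt_id' s
    · simpa using hasDerivAt_const s y
  exact ((hW.differentiable one_ne_zero) _).hasFDerivAt.comp_hasDerivAt s h1

theorem hasDerivAt_line1 {W : (Fin 2 → ℝ) → ℂ} (hW : ContDiff ℝ 1 W) (x s : ℝ) :
    HasDerivAt (fun s => W ![x, s]) (pd2 W 1 ![x, s]) s := by
  have h1 : HasDerivAt (fun s : ℝ => (![x, s] : Fin 2 → ℝ)) (Pi.single 1 1) s := by
    rw [hasDerivAt_pi]
    intro i
    fin_cases i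
    · simpa using hasDerivAt_const s x
    · simpa using hasDerivAt_id' s
  exact ((hW.differentiable one_ne_zero) _).hasFDerivAt.comp_hasDerivAt s h1

theorem continuous_pd2 {W : (Fin 2 → ℝ) → ℂ} (hW : ContDiff ℝ 1 W) (j : Fin 2) :
    Continuous (pd2 W j) :=
  (hW.continuous_fderiv one_ne_zero).clm_apply continuous_const

theorem continuous_pd3 {w : (Fin 3 → ℝ) → ℂ} (hw : ContDiff ℝ 1 w) (j : Fin 3) :
    Continuous (pd3 w j) :=
  (hw.continuous_fderiv one_ne_zero).clm_apply continuous_const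

theorem pd2_periodic {W : (Fin 2 → ℝ) → ℂ} {v : Fin 2 → ℝ} (hp : ∀ y, W (y + v) = W y)
    (j : Fin 2) (y : Fin 2 → ℝ) : pd2 W j (y + v) = pd2 W j y := by
  have h : (fun y => W (y + v)) = W := funext hp
  unfold pd2
  rw [← fderiv_comp_add_right, h]

theorem pd3_periodic {w : (Fin 3 → ℝ) → ℂ} {v : Fin 3 → ℝ} (hp : ∀ y, w (y + v) = w y)
    (j : Fin 3) (y : Fin 3 → ℝ) : pd3 w j (y + v) = pd3 w j y := by
  have h : (fun y => w (y + v)) = w := funext hp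
  unfold pd3
  rw [← fderiv_comp_add_right, h]

/-- The two-dimensional periodicity cell `[-1/2,1/2)²`. -/
def cell2 : Set (Fin 2 → ℝ) :=
  Set.univ.pi fun _ => Set.Ico (-(1 : ℝ) / 2) (1 / 2)

/-- The periodic perforated plane: points at distance at least `r` from `ℤ²`. -/
def outSet (r : ℝ) : Set (Fin 2 → ℝ) :=
  {y | ∀ m : Fin 2 → ℤ, r ^ 2 ≤ (y 0 - (m 0 : ℝ)) ^ 2 + (y 1 - (m 1 : ℝ)) ^ 2}

theorem measurableSet_outSet (r : ℝ) : MeasurableSet (outSet r) := by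
  have : IsClosed (outSet r) := by
    unfold outSet
    simp only [Set.ofPred_forall]
    exact isClosed_iInter fun m => isClosed_le continuous_const (by fun_prop)
  exact this.measurableSet

theorem measurableSet_cell2 : MeasurableSet cell2 :=
  MeasurableSet.univ_pi fun _ => measurableSet_Ico

theorem outSet_add_int {r : ℝ} (y : Fin 2 → ℝ) (m : Fin 2 → ℤ) :
    (y + fun i => (m i : ℝ)) ∈ outSet r ↔ y ∈ outSet r := by
  constructor
  · intro h k
    have := h (k + m)
    simpa [add_sub_add_right_eq_sub] using this
  · intro h k
    have := h (k - m)
    simp only [Pi.sub_apply, Int.cast_sub, Pi.add_apply] at this ⊢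
    convert this using 3 <;> ring

theorem mem_outSet_of_snd {r t : ℝ} (hr : 0 < r) (ht : t ∈ Set.Ioo r (1 - r)) (s : ℝ) :
    (![s, t] : Fin 2 → ℝ) ∈ outSet r := by
  intro m
  have h : r ^ 2 ≤ (t - (m 1 : ℝ)) ^ 2 := by
    rcases le_or_gt (m 1) 0 with h | h
    · have : (m 1 : ℝ) ≤ 0 := by exact_mod_cast h
      nlinarith [ht.1, ht.2]
    · have : (1 : ℝ) ≤ m 1 := by exact_mod_cast h
      nlinarith [ht.1, ht.2]
  simp only [Matrix.cons_val_zero, Matrix.cons_val_one]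
  nlinarith [sq_nonneg (s - (m 0 : ℝ))]

theorem mem_outSet_of_fst {r t : ℝ} (hr : 0 < r) (ht : t ∈ Set.Ioo r (1 - r)) (s : ℝ) :
    (![t, s] : Fin 2 → ℝ) ∈ outSet r := by
  intro m
  have := mem_outSet_of_snd hr ht s ![m 1, m 0]
  simp only [Matrix.cons_val_zero, Matrix.cons_val_one] at this ⊢
  linarith

theorem mem_outSet_of_mem_uIoc {r t x y s : ℝ} (hr : 0 < r) (ht : t ∈ Set.Ioo r (1 - r))
    (hx : x ∈ Set.Icc (0 : ℝ) 1) (hxy : (![x, y] : Fin 2 → ℝ) ∈ outSet r)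
    (hs : s ∈ Set.uIoc x t) : (![s, y] : Fin 2 → ℝ) ∈ outSet r := by
  intro m
  have h0 := hxy m
  have ht1 := ht.1
  have ht2 := ht.2
  have hx1 := hx.1
  have hx2 := hx.2
  simp only [Matrix.cons_val_zero, Matrix.cons_val_one] at h0 ⊢
  have h : r ^ 2 ≤ (s - (m 0 : ℝ)) ^ 2 ∨ (x - (m 0 : ℝ)) ^ 2 ≤ (s - (m 0 : ℝ)) ^ 2 := by
    rw [Set.mem_uIoc] at hs
    rcases le_or_gt (m 0) 0 with h | h
    · have : (m 0 : ℝ) ≤ 0 := by exact_mod_cast h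
      rcases hs with hs | hs
      · right; nlinarith
      · left; nlinarith
    · have : (1 : ℝ) ≤ m 0 := by exact_mod_cast h
      rcases hs with hs | hs
      · left; nlinarith
      · right; nlinarith
  rcases h with h | h
  · nlinarith [sq_nonneg (y - (m 1 : ℝ))]
  · linarith

theorem cell2_subset : cell2 ⊆ Set.Icc (fun _ => -(1 : ℝ) / 2) (fun _ => 1 / 2) := by
  intro y hy
  exact ⟨fun i => (hy i trivial).1, fun i => (hy i trivial).2.le⟩

theorem Continuous.integrableOn_cell2 {F : Type*} [NormedAddCommGroup F] [NormedSpace ℝ F]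
    {G : (Fin 2 → ℝ) → F} (hG : Continuous G) :
    IntegrableOn G cell2 :=
  (hG.integrableOn_Icc).mono_set cell2_subset

theorem integrableOn_cell2_indicator {F : Type*} [NormedAddCommGroup F] [NormedSpace ℝ F]
    {G : (Fin 2 → ℝ) → F} (hG : Continuous G) {S : Set (Fin 2 → ℝ)} (hS : MeasurableSet S) :
    IntegrableOn (S.indicator G) cell2 :=
  (hG.integrableOn_cell2).indicator hS

theorem finTwoArrow_symm_eq (p : ℝ × ℝ) :
    (MeasurableEquiv.finTwoArrow (α := ℝ)).symm p = ![p.1, p.2] := by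
  ext i; fin_cases i <;> rfl

theorem finTwoArrow_symm_preimage_cell2 :
    (MeasurableEquiv.finTwoArrow (α := ℝ)).symm ⁻¹' cell2
      = Set.Ico (-(1 : ℝ) / 2) (1 / 2) ×ˢ Set.Ico (-(1 : ℝ) / 2) (1 / 2) := by
  ext p
  rw [Set.mem_preimage, finTwoArrow_symm_eq]
  simp [cell2, Set.mem_pi, Fin.forall_fin_two]

theorem setIntegral_cell2_eq_prod (G : (Fin 2 → ℝ) → ℝ) :
    ∫ y in cell2, G y = ∫ p in Set.Ico (-(1 : ℝ) / 2) (1 / 2) ×ˢ Set.Ico (-(1 : ℝ) / 2) (1 / 2),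
      G ![p.1, p.2] := by
  have h := (volume_preserving_finTwoArrow ℝ).symm.setIntegral_preimage_emb
    (MeasurableEquiv.measurableEmbedding _) G cell2
  rw [← h, finTwoArrow_symm_preimage_cell2]
  simp_rw [finTwoArrow_symm_eq]

theorem integrableOn_prod_of_cell2 {G : (Fin 2 → ℝ) → ℝ} (hG : IntegrableOn G cell2) :
    IntegrableOn (fun p : ℝ × ℝ => G ![p.1, p.2])
      (Set.Ico (-(1 : ℝ) / 2) (1 / 2) ×ˢ Set.Ico (-(1 : ℝ) / 2) (1 / 2)) := by
  have h := ((volume_preserving_finTwoArrow ℝ).symm.integrableOn_comp_preimage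
    (MeasurableEquiv.measurableEmbedding _) (f := G) (s := cell2)).2 hG
  rw [finTwoArrow_symm_preimage_cell2] at h
  refine h.congr_fun (fun p _ => ?_) (measurableSet_Ico.prod measurableSet_Ico)
  simp only [Function.comp, finTwoArrow_symm_eq]

section shift

variable {G : (Fin 2 → ℝ) → ℝ}

theorem periodic_fst_of_periodic {X : Type*} {G : (Fin 2 → ℝ) → X}
    (hp : ∀ (y : Fin 2 → ℝ) (m : Fin 2 → ℤ), G (y + fun i => (m i : ℝ)) = G y) (y : ℝ) :
    Function.Periodic (fun x => G ![x, y]) 1 := by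
  intro x
  have := hp ![x, y] ![1, 0]
  refine Eq.trans ?_ this
  simp only
  congr 1
  ext i; fin_cases i <;> simp

theorem periodic_snd_of_periodic {X : Type*} {G : (Fin 2 → ℝ) → X}
    (hp : ∀ (y : Fin 2 → ℝ) (m : Fin 2 → ℤ), G (y + fun i => (m i : ℝ)) = G y) (x : ℝ) :
    Function.Periodic (fun y => G ![x, y]) 1 := by
  intro y
  have := hp ![x, y] ![0, 1]
  refine Eq.trans ?_ this
  simp only
  congr 1
  ext i; fin_cases i <;> simp

theorem setIntegral_Ico_eq_of_periodic {f : ℝ → ℝ} (hf : Function.Periodic f 1) :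
    ∫ x in Set.Ico (-(1 : ℝ) / 2) (1 / 2), f x = ∫ x in (0 : ℝ)..1, f x := by
  rw [integral_Ico_eq_integral_Ioc, ← intervalIntegral.integral_of_le (by norm_num)]
  have := hf.intervalIntegral_add_eq (-(1 : ℝ) / 2) 0
  rw [zero_add] at this
  rw [← this]
  norm_num

theorem setIntegral_cell2_eq_snd_fst (hG : IntegrableOn G cell2)
    (hp : ∀ (y : Fin 2 → ℝ) (m : Fin 2 → ℤ), G (y + fun i => (m i : ℝ)) = G y) :
    ∫ y in cell2, G y = ∫ x in (0 : ℝ)..1, ∫ y in (0 : ℝ)..1, G ![x, y] := by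
  rw [setIntegral_cell2_eq_prod]
  have h := integrableOn_prod_of_cell2 hG
  rw [Measure.volume_eq_prod] at h ⊢
  rw [setIntegral_prod _ h]
  simp_rw [fun x => setIntegral_Ico_eq_of_periodic (periodic_snd_of_periodic hp x)]
  refine setIntegral_Ico_eq_of_periodic fun x => ?_
  simp_rw [fun y => periodic_fst_of_periodic hp y x]

theorem setIntegral_cell2_eq_fst_snd (hG : IntegrableOn G cell2)
    (hp : ∀ (y : Fin 2 → ℝ) (m : Fin 2 → ℤ), G (y + fun i => (m i : ℝ)) = G y) :
    ∫ y in cell2, G y = ∫ y in (0 : ℝ)..1, ∫ x in (0 : ℝ)..1, G ![x, y] := by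
  rw [setIntegral_cell2_eq_prod]
  have h := integrableOn_prod_of_cell2 hG
  rw [Measure.volume_eq_prod] at h ⊢
  rw [setIntegral_prod _ h, integral_integral_swap]
  · simp_rw [fun x => setIntegral_Ico_eq_of_periodic (periodic_fst_of_periodic hp x)]
    refine setIntegral_Ico_eq_of_periodic fun x => ?_
    simp_rw [fun y => periodic_snd_of_periodic hp y x]
  · rw [Measure.prod_restrict]
    exact h

theorem intervalIntegrable_of_periodic {f : ℝ → ℝ} (hf : Function.Periodic f 1)
    (h : IntegrableOn f (Set.Ico (-(1 : ℝ) / 2) (1 / 2))) (a b : ℝ) :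
    IntervalIntegrable f volume a b := by
  have h1 : IntervalIntegrable f volume (-(1 : ℝ) / 2) (-(1 : ℝ) / 2 + 1) := by
    rw [intervalIntegrable_iff_integrableOn_Ico_of_le (by norm_num)]
    rwa [show -(1 : ℝ) / 2 + 1 = 1 / 2 by norm_num]
  exact hf.intervalIntegrable one_ne_zero h1 a b

theorem intervalIntegrable_fst (hG : IntegrableOn G cell2)
    (hp : ∀ (y : Fin 2 → ℝ) (m : Fin 2 → ℤ), G (y + fun i => (m i : ℝ)) = G y) (a b : ℝ) :
    IntervalIntegrable (fun x => ∫ y in (0 : ℝ)..1, G ![x, y]) volume a b := by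
  refine intervalIntegrable_of_periodic (fun x => ?_) ?_ a b
  · simp_rw [fun y => periodic_fst_of_periodic hp y x]
  · have h := integrableOn_prod_of_cell2 hG
    rw [IntegrableOn, Measure.volume_eq_prod, ← Measure.prod_restrict] at h
    have h2 := h.integral_prod_left
    simp only [fun x => setIntegral_Ico_eq_of_periodic (periodic_snd_of_periodic hp x)] at h2
    exact h2

theorem intervalIntegrable_snd (hG : IntegrableOn G cell2)
    (hp : ∀ (y : Fin 2 → ℝ) (m : Fin 2 → ℤ), G (y + fun i => (m i : ℝ)) = G y) (a b : ℝ) :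
    IntervalIntegrable (fun y => ∫ x in (0 : ℝ)..1, G ![x, y]) volume a b := by
  refine intervalIntegrable_of_periodic (fun x => ?_) ?_ a b
  · simp_rw [fun y => periodic_snd_of_periodic hp y x]
  · have h := integrableOn_prod_of_cell2 hG
    rw [IntegrableOn, Measure.volume_eq_prod, ← Measure.prod_restrict] at h
    have h2 := h.integral_prod_right
    simp only [fun x => setIntegral_Ico_eq_of_periodic (periodic_fst_of_periodic hp x)] at h2
    exact h2

end shift

theorem exists_mem_Ioo_le {φ : ℝ → ℝ} {r : ℝ} (hr : 0 < r) (hr' : r < 1 / 2)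
    (hφ : IntervalIntegrable φ volume 0 1) (h0 : ∀ x, 0 ≤ φ x) :
    ∃ t ∈ Set.Ioo r (1 - r), φ t ≤ (∫ x in (0 : ℝ)..1, φ x) / (1 - 2 * r) := by
  have hsub : Set.Ioo r (1 - r) ⊆ Set.Ioc 0 1 :=
    fun x hx => ⟨by linarith [hx.1], by linarith [hx.2]⟩
  have hI := (intervalIntegrable_iff_integrableOn_Ioc_of_le zero_le_one).1 hφ
  obtain ⟨t, ht, hle⟩ := exists_le_setAverage (μ := volume) (s := Set.Ioo r (1 - r)) (f := φ)
    (by simp; linarith) (by simp) (hI.mono_set hsub)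
  refine ⟨t, ht, hle.trans ?_⟩
  rw [setAverage_eq, Real.volume_real_Ioo_of_le (by linarith), smul_eq_mul,
    show 1 - r - r = 1 - 2 * r by ring, inv_mul_eq_div, intervalIntegral.integral_of_le zero_le_one]
  have : 0 < 1 - 2 * r := by linarith
  gcongr
  · exact Filter.Eventually.of_forall h0

/-- The energy density `|∇W + iθW|²` in the plane. -/
noncomputable def energyDensity (θ : Fin 2 → ℝ) (W : (Fin 2 → ℝ) → ℂ) (y : Fin 2 → ℝ) : ℝ :=
  ∑ j, ‖pd2 W j y + Complex.I * (θ j : ℂ) * W y‖ ^ 2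

theorem energyDensity_nonneg (θ : Fin 2 → ℝ) (W : (Fin 2 → ℝ) → ℂ) (y : Fin 2 → ℝ) :
    0 ≤ energyDensity θ W y :=
  Finset.sum_nonneg fun _ _ => sq_nonneg _

theorem le_energyDensity (θ : Fin 2 → ℝ) (W : (Fin 2 → ℝ) → ℂ) (y : Fin 2 → ℝ) (j : Fin 2) :
    ‖pd2 W j y + Complex.I * (θ j : ℂ) * W y‖ ^ 2 ≤ energyDensity θ W y :=
  Finset.single_le_sum (f := fun j => ‖pd2 W j y + Complex.I * (θ j : ℂ) * W y‖ ^ 2)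
    (fun _ _ => sq_nonneg _) (Finset.mem_univ j)

theorem continuous_energyDensity {θ : Fin 2 → ℝ} {W : (Fin 2 → ℝ) → ℂ} (hW : ContDiff ℝ 1 W) :
    Continuous (energyDensity θ W) := by
  have h := continuous_pd2 hW
  have := hW.continuous
  unfold energyDensity
  fun_prop

theorem indicator_outSet_periodic {r : ℝ} {G : (Fin 2 → ℝ) → ℝ}
    (hp : ∀ (y : Fin 2 → ℝ) (m : Fin 2 → ℤ), G (y + fun i => (m i : ℝ)) = G y)
    (y : Fin 2 → ℝ) (m : Fin 2 → ℤ) :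
    (outSet r).indicator G (y + fun i => (m i : ℝ)) = (outSet r).indicator G y := by
  simp only [Set.indicator, outSet_add_int, hp]

theorem energyDensity_periodic {θ : Fin 2 → ℝ} {W : (Fin 2 → ℝ) → ℂ}
    (hp : ∀ (y : Fin 2 → ℝ) (m : Fin 2 → ℤ), W (y + fun i => (m i : ℝ)) = W y)
    (y : Fin 2 → ℝ) (m : Fin 2 → ℤ) :
    energyDensity θ W (y + fun i => (m i : ℝ)) = energyDensity θ W y := by
  unfold energyDensity
  simp only [hp, fun j => pd2_periodic (fun y => hp y m) j y]

/-- Poincaré inequality in the perforated cell, pointwise along a cross of two full lines. -/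
theorem exists_cross {r : ℝ} (hr : 0 < r) (hr' : r < 1 / 2) {θ : Fin 2 → ℝ}
    (hθ : ∀ j, |θ j| ≤ Real.pi) {W : (Fin 2 → ℝ) → ℂ} (hW : ContDiff ℝ 1 W)
    (hp : ∀ (y : Fin 2 → ℝ) (m : Fin 2 → ℤ), W (y + fun i => (m i : ℝ)) = W y)
    {κ : ℝ} (hκ : κ = (∫ y in cell2, (outSet r).indicator (energyDensity θ W) y) / (1 - 2 * r)) :
    ∃ c : ℂ, (∀ j, θ j ^ 2 * ‖c‖ ^ 2 ≤ 4 * κ) ∧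
      ∀ x ∈ Set.Icc (0 : ℝ) 1, ∀ y ∈ Set.Icc (0 : ℝ) 1, (![x, y] : Fin 2 → ℝ) ∈ outSet r →
        ‖W ![x, y] - c‖ ^ 2 ≤
          4 * (∫ s in (0 : ℝ)..1, (outSet r).indicator (energyDensity θ W) ![s, y]) + 2000 * κ := by
  set e := (outSet r).indicator (energyDensity θ W) with he
  have he0 : ∀ y, 0 ≤ e y := fun y => Set.indicator_nonneg (fun y _ => energyDensity_nonneg θ W y) y
  have hep : ∀ (y : Fin 2 → ℝ) (m : Fin 2 → ℤ), e (y + fun i => (m i : ℝ)) = e y :=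
    indicator_outSet_periodic (energyDensity_periodic hp)
  have heI : IntegrableOn e cell2 :=
    integrableOn_cell2_indicator (continuous_energyDensity hW) (measurableSet_outSet r)
  have hcE := continuous_energyDensity (θ := θ) hW
  have hline0 : ∀ y a b, IntegrableOn (fun s => e ![s, y]) (Set.Ioc a b) := by
    intro y a b
    have hc : Continuous fun s : ℝ => (![s, y] : Fin 2 → ℝ) := by fun_prop
    exact (Continuous.integrableOn_Ioc (hcE.comp hc)).indicator
      (hc.measurable (measurableSet_outSet r))
  obtain ⟨t1, ht1, hE1⟩ := exists_mem_Ioo_le hr hr' (intervalIntegrable_fst heI hep 0 1)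
    fun x => intervalIntegral.integral_nonneg zero_le_one fun _ _ => he0 _
  obtain ⟨t2, ht2, hE2⟩ := exists_mem_Ioo_le hr hr' (intervalIntegrable_snd heI hep 0 1)
    fun x => intervalIntegral.integral_nonneg zero_le_one fun _ _ => he0 _
  rw [← setIntegral_cell2_eq_snd_fst heI hep, ← hκ] at hE1
  rw [← setIntegral_cell2_eq_fst_snd heI hep, ← hκ] at hE2
  have c0 := continuous_pd2 hW 0
  have c1 := continuous_pd2 hW 1
  have cW := hW.continuous
  have hV : ∫ s in (0 : ℝ)..1, ‖pd2 W 1 ![t1, s] + Complex.I * (θ 1 : ℂ) * W ![t1, s]‖ ^ 2 ≤ κ := by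
    refine le_trans (intervalIntegral.integral_mono_on zero_le_one
      (Continuous.intervalIntegrable (by fun_prop) _ _)
      (Continuous.intervalIntegrable (hcE.comp (by fun_prop)) _ _) fun s _ =>
        le_energyDensity θ W ![t1, s] 1) (le_trans (le_of_eq ?_) hE1)
    refine intervalIntegral.integral_congr fun s _ => ?_
    exact (Set.indicator_of_mem (mem_outSet_of_fst hr ht1 s) _).symm
  have hH : ∫ s in (0 : ℝ)..1, ‖pd2 W 0 ![s, t2] + Complex.I * (θ 0 : ℂ) * W ![s, t2]‖ ^ 2 ≤ κ := by
    refine le_trans (intervalIntegral.integral_mono_on zero_le_one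
      (Continuous.intervalIntegrable (by fun_prop) _ _)
      (Continuous.intervalIntegrable (hcE.comp (by fun_prop)) _ _) fun s _ =>
        le_energyDensity θ W ![s, t2] 0) (le_trans (le_of_eq ?_) hE2)
    refine intervalIntegral.integral_congr fun s _ => ?_
    exact (Set.indicator_of_mem (mem_outSet_of_snd hr ht2 s) _).symm
  have hpd : ∀ j (y : Fin 2 → ℝ) (m : Fin 2 → ℤ), pd2 W j (y + fun i => (m i : ℝ)) = pd2 W j y :=
    fun j y m => pd2_periodic (fun y => hp y m) j y
  have A1 := sq_mul_norm_sq_le_of_periodic (θ := θ 0) (hasDerivAt_line0 hW t2) (by fun_prop)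
    (periodic_fst_of_periodic hp t2) (periodic_fst_of_periodic (hpd 0) t2) (hθ 0) t1
  have A2 := sq_mul_norm_sq_le_of_periodic (θ := θ 1) (hasDerivAt_line1 hW t1) (by fun_prop)
    (periodic_snd_of_periodic hp t1) (periodic_snd_of_periodic (hpd 1) t1) (hθ 1) t2
  refine ⟨W ![t1, t2], ?_, ?_⟩
  · rw [Fin.forall_fin_two]
    constructor <;> linarith
  intro x hx y hy hxy
  have ht1' : t1 ∈ Set.Icc (0 : ℝ) 1 := ⟨by linarith [ht1.1], by linarith [ht1.2]⟩
  have ht2' : t2 ∈ Set.Icc (0 : ℝ) 1 := ⟨by linarith [ht2.1], by linarith [ht2.2]⟩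
  have habs : ∀ {s t : ℝ}, s ∈ Set.Icc (0 : ℝ) 1 → t ∈ Set.Icc (0 : ℝ) 1 → |s - t| ≤ 1 :=
    fun hs ht => abs_le.2 ⟨by linarith [hs.1, ht.2], by linarith [hs.2, ht.1]⟩
  have A3 := norm_sub_sq_le_of_periodic (θ := θ 1) (hasDerivAt_line1 hW t1) (by fun_prop)
    (periodic_snd_of_periodic hp t1) (periodic_snd_of_periodic (hpd 1) t1) (hθ 1) (habs hy ht2')
  have A4 := norm_sub_sq_le (θ := θ 0) (hasDerivAt_line0 hW y) (by fun_prop) (habs hx ht1')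
  have A5 : (∫ s in Set.uIoc x t1, ‖pd2 W 0 ![s, y] + Complex.I * (θ 0 : ℂ) * W ![s, y]‖ ^ 2)
      ≤ ∫ s in (0 : ℝ)..1, e ![s, y] := by
    rw [intervalIntegral.integral_of_le zero_le_one]
    have hsub : Set.uIoc x t1 ⊆ Set.Ioc 0 1 :=
      Set.Ioc_subset_Ioc (le_min hx.1 ht1'.1) (max_le hx.2 ht1'.2)
    refine le_trans ?_ (setIntegral_mono_set (hline0 y 0 1)
      (Filter.Eventually.of_forall fun _ => he0 _) hsub.eventuallyLE)
    refine setIntegral_mono_on (Continuous.integrableOn_uIoc (by fun_prop))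
      ((hline0 y 0 1).mono_set hsub) measurableSet_uIoc fun s hs => ?_
    rw [he, Set.indicator_of_mem (mem_outSet_of_mem_uIoc hr ht1 hx hxy hs)]
    exact le_energyDensity θ W ![s, y] 0
  have tri : ∀ a b c : ℂ, ‖a - c‖ ^ 2 ≤ 2 * ‖a - b‖ ^ 2 + 2 * ‖b - c‖ ^ 2 := by
    intro a b c
    have h1 : ‖a - c‖ ≤ ‖a - b‖ + ‖b - c‖ := norm_sub_le_norm_sub_add_norm_sub a b c
    have h2 : ‖a - c‖ ^ 2 ≤ (‖a - b‖ + ‖b - c‖) ^ 2 := by gcongr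
    nlinarith [sq_nonneg (‖a - b‖ - ‖b - c‖)]
  have B1 := tri (W ![x, y]) (W ![t1, y]) (W ![t1, t2])
  have B2 := tri (W ![t1, y]) (W ![t1, t2]) 0
  rw [sub_zero, sub_zero] at B2
  have hθ2 : θ 0 ^ 2 ≤ 16 := by
    have := hθ 0
    rw [← sq_abs]
    nlinarith [Real.pi_le_four, abs_nonneg (θ 0)]
  have hκ0 : 0 ≤ κ := le_trans
    (intervalIntegral.integral_nonneg zero_le_one fun _ _ => sq_nonneg _) hV
  have B3 : θ 0 ^ 2 * ‖W ![t1, y]‖ ^ 2 ≤ 2 * 16 * (10 * κ) + 2 * (4 * κ) := by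
    calc θ 0 ^ 2 * ‖W ![t1, y]‖ ^ 2
        ≤ θ 0 ^ 2 * (2 * ‖W ![t1, y] - W ![t1, t2]‖ ^ 2 + 2 * ‖W ![t1, t2]‖ ^ 2) := by gcongr
      _ = 2 * θ 0 ^ 2 * ‖W ![t1, y] - W ![t1, t2]‖ ^ 2 + 2 * (θ 0 ^ 2 * ‖W ![t1, t2]‖ ^ 2) := by ring
      _ ≤ 2 * 16 * (10 * κ) + 2 * (4 * κ) := by
        have p1 : θ 0 ^ 2 * ‖W ![t1, y] - W ![t1, t2]‖ ^ 2 ≤ 16 * (10 * κ) :=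
          mul_le_mul hθ2 (by linarith) (sq_nonneg _) (by norm_num)
        linarith
  linarith

theorem exists_poincare_outSet {r : ℝ} (hr : 0 < r) (hr' : r < 1 / 2) :
    ∃ C > 0, ∀ θ : Fin 2 → ℝ, (∀ j, |θ j| ≤ Real.pi) → ∀ W : (Fin 2 → ℝ) → ℂ, ContDiff ℝ 1 W →
      (∀ (y : Fin 2 → ℝ) (m : Fin 2 → ℤ), W (y + fun i => (m i : ℝ)) = W y) →
      ∃ c : ℂ,
        ∫ y in cell2, (outSet r).indicator (fun y => ‖W y - c‖ ^ 2 + energyDensity 0 W y) y ≤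
          C * ∫ y in cell2, (outSet r).indicator (energyDensity θ W) y := by
  have hpos : 0 < 1 - 2 * r := by linarith
  refine ⟨1000 + 1000000 / (1 - 2 * r), by positivity, fun θ hθ W hW hp => ?_⟩
  obtain ⟨c, hc, hW2⟩ := exists_cross hr hr' hθ hW hp rfl
  refine ⟨c, ?_⟩
  set e := (outSet r).indicator (energyDensity θ W) with he
  set κ := (∫ y in cell2, e y) / (1 - 2 * r) with hκ
  have he0 : ∀ y, 0 ≤ e y := fun y => Set.indicator_nonneg (fun y _ => energyDensity_nonneg θ W y) y
  have hκ0 : 0 ≤ κ := div_nonneg (integral_nonneg he0) hpos.le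
  have hep : ∀ (y : Fin 2 → ℝ) (m : Fin 2 → ℤ), e (y + fun i => (m i : ℝ)) = e y :=
    indicator_outSet_periodic (energyDensity_periodic hp)
  have heI : IntegrableOn e cell2 :=
    integrableOn_cell2_indicator (continuous_energyDensity hW) (measurableSet_outSet r)
  set Φ : ℝ → ℝ := fun y => ∫ s in (0 : ℝ)..1, e ![s, y] with hΦ
  have hΦI : ∫ y in (0 : ℝ)..1, Φ y = ∫ y in cell2, e y :=
    (setIntegral_cell2_eq_fst_snd heI hep).symm
  have hΦint : IntervalIntegrable Φ volume 0 1 := intervalIntegrable_snd heI hep 0 1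
  have hΦ0 : ∀ y, 0 ≤ Φ y := fun y =>
    intervalIntegral.integral_nonneg zero_le_one fun _ _ => he0 _
  set G : (Fin 2 → ℝ) → ℝ := fun y => ‖W y - c‖ ^ 2 + energyDensity 0 W y with hG
  have cW := hW.continuous
  have hcE := continuous_energyDensity (θ := θ) hW
  have hcE0 := continuous_energyDensity (θ := 0) hW
  have hGc : Continuous G := by fun_prop
  have hGI := integrableOn_cell2_indicator hGc (measurableSet_outSet r)
  have hGp : ∀ (y : Fin 2 → ℝ) (m : Fin 2 → ℤ), G (y + fun i => (m i : ℝ)) = G y := by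
    intro y m
    simp only [hG, hp, energyDensity_periodic hp]
  have hθ2 : ∀ j, θ j ^ 2 ≤ 16 := by
    intro j
    have := hθ j
    rw [← sq_abs]
    nlinarith [Real.pi_le_four, abs_nonneg (θ j)]
  have hsum : ∀ y, energyDensity 0 W y ≤
      2 * energyDensity θ W y + 128 * ‖W y - c‖ ^ 2 + 32 * κ := by
    intro y
    have h : ∀ j, ‖pd2 W j y + Complex.I * (((0 : Fin 2 → ℝ) j : ℝ) : ℂ) * W y‖ ^ 2 ≤
        2 * ‖pd2 W j y + Complex.I * (θ j : ℂ) * W y‖ ^ 2 + 64 * ‖W y - c‖ ^ 2 + 16 * κ := by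
      intro j
      have h1 : ‖pd2 W j y + Complex.I * (((0 : Fin 2 → ℝ) j : ℝ) : ℂ) * W y‖ ≤
          ‖pd2 W j y + Complex.I * (θ j : ℂ) * W y‖ + |θ j| * (‖W y - c‖ + ‖c‖) := by
        calc _ = ‖(pd2 W j y + Complex.I * (θ j : ℂ) * W y)
              - Complex.I * (θ j : ℂ) * ((W y - c) + c)‖ := by
                congr 1; simp only [Pi.zero_apply, Complex.ofReal_zero]; ring
          _ ≤ _ := by
            refine (norm_sub_le _ _).trans ?_
            rw [norm_mul, norm_mul, Complex.norm_I, one_mul, Complex.norm_real, Real.norm_eq_abs]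
            gcongr
            exact norm_add_le _ _
      have h2 := pow_le_pow_left₀ (norm_nonneg _) h1 2
      have h3 : (|θ j| * ‖W y - c‖) ^ 2 ≤ 16 * ‖W y - c‖ ^ 2 := by
        rw [mul_pow, sq_abs]
        exact mul_le_mul_of_nonneg_right (hθ2 j) (sq_nonneg _)
      have h4 : (|θ j| * ‖c‖) ^ 2 ≤ 4 * κ := by
        rw [mul_pow, sq_abs]; exact hc j
      nlinarith [sq_nonneg (‖pd2 W j y + Complex.I * (θ j : ℂ) * W y‖ -
        |θ j| * (‖W y - c‖ + ‖c‖)), sq_nonneg (|θ j| * ‖W y - c‖ - |θ j| * ‖c‖)]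
    unfold energyDensity
    simp only [Fin.sum_univ_two]
    have := h 0
    have := h 1
    linarith
  have hpt : ∀ x ∈ Set.Icc (0 : ℝ) 1, ∀ y ∈ Set.Icc (0 : ℝ) 1,
      (outSet r).indicator G ![x, y] ≤ 2 * e ![x, y] + (516 * Φ y + 300000 * κ) := by
    intro x hx y hy
    by_cases hxy : (![x, y] : Fin 2 → ℝ) ∈ outSet r
    · have h1 := hW2 x hx y hy hxy
      have h2 := hsum ![x, y]
      rw [he, Set.indicator_of_mem hxy, Set.indicator_of_mem hxy]
      simp only [hG]
      change ‖W ![x, y] - c‖ ^ 2 ≤ 4 * Φ y + 2000 * κ at h1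
      linarith
    · rw [Set.indicator_of_notMem hxy]
      have := he0 ![x, y]
      have := hΦ0 y
      positivity
  rw [setIntegral_cell2_eq_fst_snd hGI (indicator_outSet_periodic hGp)]
  have hslice : ∀ {F : (Fin 2 → ℝ) → ℝ}, Continuous F → ∀ y,
      IntervalIntegrable (fun x => (outSet r).indicator F ![x, y]) volume 0 1 := by
    intro F hF y
    have hl : Continuous fun s : ℝ => (![s, y] : Fin 2 → ℝ) := by fun_prop
    rw [intervalIntegrable_iff_integrableOn_Ioc_of_le zero_le_one]
    exact (Continuous.integrableOn_Ioc (hF.comp hl)).indicator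
      (hl.measurable (measurableSet_outSet r))
  have hin : ∀ y ∈ Set.Icc (0 : ℝ) 1, ∫ x in (0 : ℝ)..1, (outSet r).indicator G ![x, y]
      ≤ 518 * Φ y + 300000 * κ := by
    intro y hy
    calc _ ≤ ∫ x in (0 : ℝ)..1, (2 * e ![x, y] + (516 * Φ y + 300000 * κ)) := by
          refine intervalIntegral.integral_mono_on zero_le_one (hslice hGc y)
            (((hslice hcE y).const_mul 2).add intervalIntegrable_const) fun x hx => hpt x hx y hy
      _ = 2 * Φ y + (516 * Φ y + 300000 * κ) := by
          rw [intervalIntegral.integral_add ((hslice hcE y).const_mul 2) intervalIntegrable_const,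
            intervalIntegral.integral_const_mul, intervalIntegral.integral_const]
          simp [hΦ, he]
      _ = _ := by ring
  calc _ ≤ ∫ y in (0 : ℝ)..1, (518 * Φ y + 300000 * κ) :=
        intervalIntegral.integral_mono_on zero_le_one
          (intervalIntegrable_snd hGI (indicator_outSet_periodic hGp) 0 1)
          ((hΦint.const_mul _).add intervalIntegrable_const) hin
    _ = 518 * (∫ y in cell2, e y) + 300000 * κ := by
        rw [intervalIntegral.integral_add (hΦint.const_mul _) intervalIntegrable_const,
            intervalIntegral.integral_const_mul, intervalIntegral.integral_const, hΦI]
        simp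
    _ ≤ _ := by
        have h0 : 0 ≤ ∫ y in cell2, e y := integral_nonneg he0
        have : (1000 + 1000000 / (1 - 2 * r)) * ∫ y in cell2, e y
          = 1000 * (∫ y in cell2, e y) + 1000000 * κ := by rw [hκ]; ring
        rw [this]
        linarith

/-- A compactly supported `C¹` function is `C¹`-approximated by smooth functions supported in any
prescribed open neighbourhood of its support. -/
theorem exists_smooth_approx {z : (Fin 2 → ℝ) → ℂ} {S : Set (Fin 2 → ℝ)} (hz : ContDiff ℝ 1 z)
    (hc : HasCompactSupport z) (hS : IsOpen S) (hzS : tsupport z ⊆ S) {ε : ℝ} (hε : 0 < ε) :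
    ∃ ζ : (Fin 2 → ℝ) → ℂ, ContDiff ℝ (⊤ : ℕ∞) ζ ∧ HasCompactSupport ζ ∧ tsupport ζ ⊆ S ∧
      (∀ y, ‖ζ y - z y‖ ≤ ε) ∧ ∀ j y, ‖pd2 ζ j y - pd2 z j y‖ ≤ ε := by
  have hpc : ∀ j, HasCompactSupport (pd2 z j) := fun j => hc.fderiv_apply ℝ _
  obtain ⟨d, hd, hdS⟩ := (hc.isCompact).exists_cthickening_subset_open hS hzS
  obtain ⟨d0, hd0, h0⟩ := Metric.uniformContinuous_iff.1
    (hc.uniformContinuous_of_continuous hz.continuous) ε hε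
  have hdj : ∀ j, ∃ dj > 0, ∀ {a b : Fin 2 → ℝ}, dist a b < dj → dist (pd2 z j a) (pd2 z j b) < ε :=
    fun j => Metric.uniformContinuous_iff.1
      ((hpc j).uniformContinuous_of_continuous (continuous_pd2 hz j)) ε hε
  choose dj hdj hj using hdj
  set e := min (min d d0) (min (dj 0) (dj 1)) with he
  have he0 : 0 < e := by simp [he, hd, hd0, hdj]
  let φ : ContDiffBump (0 : Fin 2 → ℝ) := ⟨e / 2, e, half_pos he0, half_lt_self he0⟩
  have hφl : LocallyIntegrable (φ.normed volume) volume :=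
    (φ.continuous_normed).locallyIntegrable
  set ζ : (Fin 2 → ℝ) → ℂ :=
    convolution (φ.normed volume) z (ContinuousLinearMap.lsmul ℝ ℝ) volume with hζ
  have hpd : ∀ j y, pd2 ζ j y =
      convolution (φ.normed volume) (pd2 z j) (ContinuousLinearMap.lsmul ℝ ℝ) volume y := by
    intro j y
    rw [pd2, (hc.hasFDerivAt_convolution_right _ hφl hz y).fderiv,
      convolution_precompR_apply _ hφl (hc.fderiv ℝ) (hz.continuous_fderiv one_ne_zero)]
    rfl
  have hsub : tsupport ζ ⊆ Metric.cthickening d (tsupport z) := by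
    refine closure_minimal ?_ Metric.isClosed_cthickening
    intro y hy
    obtain ⟨a, ha, b, hb, rfl⟩ := support_convolution_subset _ hy
    rw [φ.support_normed_eq] at ha
    refine Metric.mem_cthickening_of_dist_le _ b _ _ (subset_tsupport _ hb) ?_
    rw [dist_eq_norm, add_sub_cancel_right]
    rw [Metric.mem_ball, dist_zero_right] at ha
    exact ha.le.trans ((min_le_left _ _).trans (min_le_left _ _))
  refine ⟨ζ, ?_, ?_, hsub.trans hdS, fun y => ?_, fun j y => ?_⟩
  · exact φ.hasCompactSupport_normed.contDiff_convolution_left _ φ.contDiff_normed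
      hz.continuous.locallyIntegrable
  · exact hc.isCompact.cthickening.of_isClosed_subset (isClosed_tsupport _) hsub
  · rw [← dist_eq_norm]
    refine φ.dist_normed_convolution_le hz.continuous.aestronglyMeasurable fun x hx => (h0 ?_).le
    exact (Metric.mem_ball.1 hx).trans_le ((min_le_left _ _).trans (min_le_right _ _))
  · rw [← dist_eq_norm, hpd]
    refine φ.dist_normed_convolution_le (continuous_pd2 hz j).aestronglyMeasurable
      fun x hx => (hj j ?_).le
    refine (Metric.mem_ball.1 hx).trans_le ((min_le_right _ _).trans ?_)
    fin_cases j
    · exact min_le_left _ _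
    · exact min_le_right _ _

theorem isOpen_Bset (r : ℝ) : IsOpen (Bset r) :=
  isOpen_lt (by fun_prop) continuous_const

theorem measurableSet_Bset (r : ℝ) : MeasurableSet (Bset r) :=
  (isOpen_Bset r).measurableSet

theorem Bset_subset_cell2 {r : ℝ} (hr : 0 < r) (hr' : r < 1 / 2) : Bset r ⊆ cell2 := by
  intro y hy
  simp only [Bset, Set.mem_ofPred_eq] at hy
  intro i _
  have hi : y i ^ 2 < r ^ 2 := by
    fin_cases i
    · simpa using! lt_of_le_of_lt (le_add_of_nonneg_right (sq_nonneg (y 1))) hy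
    · simpa using! lt_of_le_of_lt (le_add_of_nonneg_left (sq_nonneg (y 0))) hy
  have := abs_lt.1 (abs_lt_of_sq_lt_sq hi hr.le)
  exact ⟨by linarith [this.1], by linarith [this.2]⟩

/-- The density of the pairing `⟨W, ζ⟩_{H¹}`. -/
noncomputable def pairing (W ζ : (Fin 2 → ℝ) → ℂ) (y : Fin 2 → ℝ) : ℂ :=
  pd2 W 0 y * star (pd2 ζ 0 y) + pd2 W 1 y * star (pd2 ζ 1 y) + W y * star (ζ y)

theorem continuous_pairing {W ζ : (Fin 2 → ℝ) → ℂ} (hW : ContDiff ℝ 1 W) (hζ : ContDiff ℝ 1 ζ) :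
    Continuous (pairing W ζ) := by
  have := continuous_pd2 hW
  have := continuous_pd2 hζ
  have := hW.continuous
  have := hζ.continuous
  unfold pairing
  fun_prop

theorem pairing_eq_zero_of_smooth {W : (Fin 2 → ℝ) → ℂ} {r : ℝ} (hr : 0 < r) (hr' : r < 1 / 2)
    (hW : ContDiff ℝ 1 W)
    (H : ∀ ζ : (Fin 2 → ℝ) → ℂ, ContDiff ℝ (⊤ : ℕ∞) ζ → HasCompactSupport ζ →
      tsupport ζ ⊆ Bset r → ∫ y in Bset r, pairing W ζ y = 0)
    {z : (Fin 2 → ℝ) → ℂ} (hz : ContDiff ℝ 1 z) (hc : HasCompactSupport z)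
    (hzS : tsupport z ⊆ Bset r) : ∫ y in Bset r, pairing W z y = 0 := by
  set M := ∫ y in Bset r, (‖pd2 W 0 y‖ + ‖pd2 W 1 y‖ + ‖W y‖) with hM
  have hcW := continuous_pd2 hW
  have hcW' := hW.continuous
  have hint : ∀ {F : Type} [NormedAddCommGroup F] [NormedSpace ℝ F] {G : (Fin 2 → ℝ) → F},
      Continuous G → IntegrableOn G (Bset r) := fun hG =>
    (hG.integrableOn_cell2).mono_set (Bset_subset_cell2 hr hr')
  have hM0 : 0 ≤ M := integral_nonneg fun y => by positivity
  have key : ∀ ε > 0, ‖∫ y in Bset r, pairing W z y‖ ≤ ε * M := by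
    intro ε hε
    obtain ⟨ζ, hζ, hζc, hζS, h0, h1⟩ := exists_smooth_approx hz hc (isOpen_Bset r) hzS hε
    have hζ1 : ContDiff ℝ 1 ζ := hζ.of_le (by exact_mod_cast le_top)
    have e : ∫ y in Bset r, pairing W z y = ∫ y in Bset r, (pairing W z y - pairing W ζ y) := by
      rw [integral_sub (hint (continuous_pairing hW hz)) (hint (continuous_pairing hW hζ1)),
        H ζ hζ hζc hζS, sub_zero]
    rw [e, hM, ← integral_const_mul]
    refine norm_integral_le_of_norm_le (hint (by fun_prop))
      (Filter.Eventually.of_forall fun y => ?_)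
    have e2 : pairing W z y - pairing W ζ y =
        pd2 W 0 y * star (pd2 z 0 y - pd2 ζ 0 y) + pd2 W 1 y * star (pd2 z 1 y - pd2 ζ 1 y) +
          W y * star (z y - ζ y) := by
      simp only [pairing, star_sub]; ring
    rw [e2]
    refine (norm_add₃_le).trans ?_
    simp only [norm_mul, norm_star]
    rw [norm_sub_rev (pd2 z 0 y), norm_sub_rev (pd2 z 1 y), norm_sub_rev (z y)]
    nlinarith [mul_le_mul_of_nonneg_left (h1 0 y) (norm_nonneg (pd2 W 0 y)),
      mul_le_mul_of_nonneg_left (h1 1 y) (norm_nonneg (pd2 W 1 y)),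
      mul_le_mul_of_nonneg_left (h0 y) (norm_nonneg (W y))]
  have : ‖∫ y in Bset r, pairing W z y‖ ≤ 0 := by
    refine le_of_forall_pos_le_add fun ε hε => ?_
    have := key (ε / (M + 1)) (by positivity)
    refine this.trans ?_
    rw [zero_add, div_mul_eq_mul_div, div_le_iff₀ (by positivity)]
    nlinarith
  simpa using this

/-- Cutoffs `q_n` of the identity of `[0, ∞)` which vanish near `0` and have uniformly bounded
slopes. -/
theorem exists_cutoff : ∃ K : ℝ, ∃ q : ℕ → ℝ → ℝ, ∀ n : ℕ, ContDiff ℝ 1 (q n) ∧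
    (∀ s, s ≤ 1 / (n + 1 : ℝ) → q n s = 0) ∧ (∀ s, |deriv (q n) s| ≤ K) ∧
    (∀ s, 0 ≤ s → |q n s| ≤ s) ∧
    ∀ s, 2 / (n + 1 : ℝ) < s → q n s = s ∧ deriv (q n) s = 1 := by
  have hcont : Continuous (deriv Real.smoothTransition) :=
    (Real.smoothTransition.contDiff (n := 1)).continuous_deriv le_rfl
  obtain ⟨M, hM⟩ := (isCompact_Icc (a := (0 : ℝ)) (b := 1)).exists_bound_of_continuousOn
    hcont.continuousOn
  have h1 : ∀ x, 1 < x → deriv Real.smoothTransition x = 0 := by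
    intro x hx
    have : Real.smoothTransition =ᶠ[nhds x] fun _ => 1 := by
      filter_upwards [lt_mem_nhds hx] with y hy
      exact Real.smoothTransition.one_of_one_le hy.le
    rw [this.deriv_eq, deriv_const]
  have h0 : ∀ x, x < 0 → deriv Real.smoothTransition x = 0 := by
    intro x hx
    have : Real.smoothTransition =ᶠ[nhds x] fun _ => 0 := by
      filter_upwards [gt_mem_nhds hx] with y hy
      exact Real.smoothTransition.zero_of_nonpos hy.le
    rw [this.deriv_eq, deriv_const]
  have hM0 : 0 ≤ M := (norm_nonneg _).trans (hM 0 (by simp))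
  have hder : ∀ (n : ℕ) (s : ℝ), HasDerivAt
      (fun s : ℝ => s * Real.smoothTransition ((n + 1 : ℝ) * s - 1))
      (1 * Real.smoothTransition ((n + 1 : ℝ) * s - 1) +
        s * (deriv Real.smoothTransition ((n + 1 : ℝ) * s - 1) * ((n + 1 : ℝ) * 1))) s := by
    intro n s
    have hS : HasDerivAt Real.smoothTransition
        (deriv Real.smoothTransition ((n + 1 : ℝ) * s - 1)) ((n + 1 : ℝ) * s - 1) :=
      (((Real.smoothTransition.contDiff (n := 1)).differentiable one_ne_zero) _).hasDerivAt
    have hlin : HasDerivAt (fun s : ℝ => (n + 1 : ℝ) * s - 1) ((n + 1 : ℝ) * 1) s :=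
      ((hasDerivAt_id s).const_mul (n + 1 : ℝ)).sub_const 1
    have hcomp : HasDerivAt (fun s : ℝ => Real.smoothTransition ((n + 1 : ℝ) * s - 1))
        (deriv Real.smoothTransition ((n + 1 : ℝ) * s - 1) * ((n + 1 : ℝ) * 1)) s :=
      HasDerivAt.comp (h₂ := Real.smoothTransition) s hS hlin
    exact (hasDerivAt_id s).mul hcomp
  refine ⟨1 + 2 * M, fun n s => s * Real.smoothTransition ((n + 1 : ℝ) * s - 1), fun n => ?_⟩
  have hn : (0 : ℝ) < n + 1 := by positivity
  refine ⟨?_, fun s hs => ?_, fun s => ?_, fun s hs => ?_, fun s hs => ?_⟩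
  · exact contDiff_id.mul ((Real.smoothTransition.contDiff (n := 1)).comp (by fun_prop))
  · rw [le_div_iff₀ hn] at hs
    have hx : (n + 1 : ℝ) * s - 1 ≤ 0 := by linarith
    simp only [Real.smoothTransition.zero_of_nonpos hx, mul_zero]
  · rw [(hder n s).deriv]
    refine (abs_add_le _ _).trans (add_le_add ?_ ?_)
    · rw [one_mul, abs_of_nonneg (Real.smoothTransition.nonneg _)]
      exact Real.smoothTransition.le_one _
    · by_cases hx : (n + 1 : ℝ) * s - 1 ∈ Set.Icc (0 : ℝ) 1
      · have hb := hM _ hx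
        rw [Real.norm_eq_abs] at hb
        have e : |s * (deriv Real.smoothTransition ((n + 1 : ℝ) * s - 1) * ((n + 1 : ℝ) * 1))| =
            ((n + 1 : ℝ) * s) * |deriv Real.smoothTransition ((n + 1 : ℝ) * s - 1)| := by
          have hs : 0 ≤ (n + 1 : ℝ) * s := by linarith [hx.1]
          rw [← abs_of_nonneg hs, ← abs_mul, abs_of_nonneg hs]
          congr 1; ring
        rw [e]
        exact mul_le_mul (by linarith [hx.2]) hb (abs_nonneg _) (by norm_num)
      · have : deriv Real.smoothTransition ((n + 1 : ℝ) * s - 1) = 0 := by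
          by_cases h : (n + 1 : ℝ) * s - 1 < 0
          · exact h0 _ h
          · exact h1 _ (lt_of_not_ge fun h' => hx ⟨not_lt.1 h, h'⟩)
        simp [this, hM0]
  · rw [abs_mul, abs_of_nonneg hs, abs_of_nonneg (Real.smoothTransition.nonneg _)]
    exact mul_le_of_le_one_right hs (Real.smoothTransition.le_one _)
  · rw [div_lt_iff₀ hn] at hs
    have h1' : 1 < (n + 1 : ℝ) * s - 1 := by linarith
    have hone := Real.smoothTransition.one_of_one_le h1'.le
    rw [(hder n s).deriv, h1 _ h1', hone]
    simp [hone]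

theorem pd2_cutoff_smul {q : ℝ → ℝ} (hq : ContDiff ℝ 1 q) {g : (Fin 2 → ℝ) → ℂ}
    (hg : ContDiff ℝ 1 g) (r : ℝ) (j : Fin 2) (y : Fin 2 → ℝ) :
    pd2 (fun y => (q (r ^ 2 - (y 0 ^ 2 + y 1 ^ 2)) / 2) • g y) j y =
      (q (r ^ 2 - (y 0 ^ 2 + y 1 ^ 2)) / 2) • pd2 g j y -
        (y j * deriv q (r ^ 2 - (y 0 ^ 2 + y 1 ^ 2))) • g y := by
  have hp : ∀ i : Fin 2, HasFDerivAt (fun y : Fin 2 → ℝ => y i)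
      (ContinuousLinearMap.proj (R := ℝ) (φ := fun _ : Fin 2 => ℝ) i) y := fun i =>
    (ContinuousLinearMap.proj (R := ℝ) (φ := fun _ : Fin 2 => ℝ) i).hasFDerivAt
  have hs := ((((hp 0).pow 2).add ((hp 1).pow 2)).const_sub (r ^ 2))
  have hqd : HasDerivAt q (deriv q (r ^ 2 - (y 0 ^ 2 + y 1 ^ 2))) (r ^ 2 - (y 0 ^ 2 + y 1 ^ 2)) :=
    ((hq.differentiable one_ne_zero) _).hasDerivAt
  have hqs := (hqd.comp_hasFDerivAt y hs).mul_const ((2 : ℝ)⁻¹)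
  have hz := hqs.smul ((hg.differentiable one_ne_zero) y).hasFDerivAt
  rw [pd2, pd2]
  have e : (fun y : Fin 2 → ℝ => (q (r ^ 2 - (y 0 ^ 2 + y 1 ^ 2)) / 2) • g y) =
      fun y : Fin 2 → ℝ => (q (r ^ 2 - (y 0 ^ 2 + y 1 ^ 2)) * 2⁻¹) • g y := by
    ext y; rw [div_eq_mul_inv]
  rw [e]
  refine (congrArg (fun L : (Fin 2 → ℝ) →L[ℝ] ℂ => L (Pi.single j 1)) hz.fderiv).trans ?_
  fin_cases j
  · simp [div_eq_mul_inv]; ring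
  · simp [div_eq_mul_inv]; ring

/-- The identity obtained by testing the weak equation with `ψ (W - c)`,
`ψ = (r² - |y|²) / 2`. -/
theorem virial_identity {W : (Fin 2 → ℝ) → ℂ} {r : ℝ} (hr : 0 < r) (hr' : r < 1 / 2)
    (hW : ContDiff ℝ 1 W)
    (H : ∀ z : (Fin 2 → ℝ) → ℂ, ContDiff ℝ 1 z → HasCompactSupport z →
      tsupport z ⊆ Bset r → ∫ y in Bset r, pairing W z y = 0) (c : ℂ) :
    ∫ y in Bset r, ((r ^ 2 - (y 0 ^ 2 + y 1 ^ 2)) / 2 *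
        (‖pd2 W 0 y‖ ^ 2 + ‖pd2 W 1 y‖ ^ 2 + (W y * star (W y - c)).re) -
      (y 0 * (pd2 W 0 y * star (W y - c)).re + y 1 * (pd2 W 1 y * star (W y - c)).re)) = 0 := by
  obtain ⟨K, q, hq⟩ := exists_cutoff
  set s : (Fin 2 → ℝ) → ℝ := fun y => r ^ 2 - (y 0 ^ 2 + y 1 ^ 2) with hs
  have hsc : Continuous s := by fun_prop
  have hg : ContDiff ℝ 1 (fun y => W y - c) := hW.sub contDiff_const
  have hpg : ∀ j y, pd2 (fun y => W y - c) j y = pd2 W j y := fun j y => by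
    simp only [pd2, fderiv_sub_const]
  let z : ℕ → (Fin 2 → ℝ) → ℂ := fun n y => (q n (s y) / 2) • (W y - c)
  have hzd : ∀ n, ContDiff ℝ 1 (z n) := fun n =>
    (((hq n).1.comp (by simp only [hs]; fun_prop)).div_const 2).smul hg
  have hsub : ∀ n, tsupport (z n) ⊆ {y | 1 / (n + 1 : ℝ) ≤ s y} := fun n => by
    refine closure_minimal ?_ (isClosed_le continuous_const hsc)
    intro y hy
    by_contra h
    refine hy ?_
    simp only [z, (hq n).2.1 (s y) (not_le.1 h).le, zero_div, zero_smul]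
  have hsubB : ∀ n, tsupport (z n) ⊆ Bset r := fun n y hy => by
    have h1 : 1 / (n + 1 : ℝ) ≤ s y := hsub n hy
    have h2 : (0 : ℝ) < 1 / (n + 1 : ℝ) := by positivity
    simp only [hs] at h1
    simp only [Bset, Set.mem_ofPred_eq]
    linarith
  have hcs : ∀ n, HasCompactSupport (z n) := fun n =>
    (isCompact_Icc).of_isClosed_subset (isClosed_tsupport _)
      (((hsubB n).trans (Bset_subset_cell2 hr hr')).trans cell2_subset)
  have hre : ∀ n y, (pairing W (z n) y).re =
      q n (s y) / 2 * (‖pd2 W 0 y‖ ^ 2 + ‖pd2 W 1 y‖ ^ 2 + (W y * star (W y - c)).re) -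
      deriv (q n) (s y) *
        (y 0 * (pd2 W 0 y * star (W y - c)).re + y 1 * (pd2 W 1 y * star (W y - c)).re) := by
    intro n y
    have hz' : ∀ j, pd2 (z n) j y =
        (q n (s y) / 2) • pd2 W j y - (y j * deriv (q n) (s y)) • (W y - c) := fun j => by
      rw [← hpg j y]; exact pd2_cutoff_smul (hq n).1 hg r j y
    rw [pairing, hz', hz']
    simp only [z]
    rw [← Complex.normSq_eq_norm_sq, ← Complex.normSq_eq_norm_sq]
    simp [Complex.normSq_apply]
    ring
  have hint : ∀ {F : Type} [NormedAddCommGroup F] [NormedSpace ℝ F] {G : (Fin 2 → ℝ) → F},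
      Continuous G → IntegrableOn G (Bset r) := fun hG =>
    (hG.integrableOn_cell2).mono_set (Bset_subset_cell2 hr hr')
  have hz0 : ∀ n, ∫ y in Bset r, (pairing W (z n) y).re = 0 := fun n => by
    have h := H (z n) (hzd n) (hcs n) (hsubB n)
    have h2 := integral_re (𝕜 := ℂ) (hint (continuous_pairing hW (hzd n)))
    rw [h] at h2
    simpa using! h2
  have hcW := continuous_pd2 hW
  have hcW' := hW.continuous
  have htend : Filter.Tendsto (fun n => ∫ y in Bset r, (pairing W (z n) y).re) Filter.atTop
      (nhds (∫ y in Bset r, (s y / 2 *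
        (‖pd2 W 0 y‖ ^ 2 + ‖pd2 W 1 y‖ ^ 2 + (W y * star (W y - c)).re) -
      (y 0 * (pd2 W 0 y * star (W y - c)).re + y 1 * (pd2 W 1 y * star (W y - c)).re)))) := by
    refine tendsto_integral_of_dominated_convergence (fun y =>
      |s y| * |‖pd2 W 0 y‖ ^ 2 + ‖pd2 W 1 y‖ ^ 2 + (W y * star (W y - c)).re| +
        K * |y 0 * (pd2 W 0 y * star (W y - c)).re + y 1 * (pd2 W 1 y * star (W y - c)).re|)
      (fun n => ?_) (hint ?_) (fun n => ?_) ?_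
    · exact (Complex.continuous_re.comp (continuous_pairing hW (hzd n))).aestronglyMeasurable
    · have : Continuous fun y => (W y * star (W y - c)).re := by fun_prop
      have : ∀ j, Continuous fun y => (pd2 W j y * star (W y - c)).re := fun j => by fun_prop
      fun_prop
    · refine (ae_restrict_iff' (measurableSet_Bset r)).2
        (Filter.Eventually.of_forall fun y hy => ?_)
      have hsy : 0 ≤ s y := by
        simp only [Bset, Set.mem_ofPred_eq] at hy; simp only [hs]; linarith
      rw [hre, Real.norm_eq_abs]
      refine (abs_sub _ _).trans (add_le_add ?_ ?_)
      · rw [abs_mul, abs_of_nonneg hsy, abs_div]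
        refine mul_le_mul_of_nonneg_right ?_ (abs_nonneg _)
        have := (hq n).2.2.2.1 (s y) hsy
        have := abs_nonneg (q n (s y))
        rw [abs_two]; linarith
      · rw [abs_mul]
        exact mul_le_mul_of_nonneg_right ((hq n).2.2.1 _) (abs_nonneg _)
    · refine (ae_restrict_iff' (measurableSet_Bset r)).2
        (Filter.Eventually.of_forall fun y hy => ?_)
      have hsy : 0 < s y := by
        simp only [Bset, Set.mem_ofPred_eq] at hy; simp only [hs]; linarith
      obtain ⟨N, hN⟩ := exists_nat_gt (2 / s y)
      refine tendsto_const_nhds.congr' ?_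
      filter_upwards [Filter.eventually_ge_atTop N] with n hn
      have hn' : (2 : ℝ) / (n + 1 : ℝ) < s y := by
        have : (N : ℝ) ≤ n := by exact_mod_cast hn
        rw [div_lt_iff₀ hsy] at hN
        rw [div_lt_iff₀ (by positivity)]
        nlinarith
      rw [hre, ((hq n).2.2.2.2 _ hn').1, ((hq n).2.2.2.2 _ hn').2, one_mul]
  simp only [hz0] at htend
  exact (tendsto_nhds_unique tendsto_const_nhds htend).symm

theorem closedBall_subset_cell2 {R : ℝ} (hR : R < 1 / 2) :
    Metric.closedBall (0 : Fin 2 → ℝ) R ⊆ cell2 := by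
  intro y hy i _
  rw [mem_closedBall_zero_iff] at hy
  have h := abs_le.1 (((Real.norm_eq_abs _).symm.le.trans (norm_le_pi_norm y i)).trans hy)
  exact ⟨by linarith [h.1], by linarith [h.2]⟩

theorem Bset_subset_ball {r : ℝ} (hr : 0 < r) : Bset r ⊆ Metric.ball (0 : Fin 2 → ℝ) r := by
  intro y hy
  simp only [Bset, Set.mem_ofPred_eq] at hy
  rw [mem_ball_zero_iff, pi_norm_lt_iff hr]
  intro i
  rw [Real.norm_eq_abs]
  refine abs_lt_of_sq_lt_sq ?_ hr.le
  fin_cases i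
  · simpa using! lt_of_le_of_lt (le_add_of_nonneg_right (sq_nonneg (y 1))) hy
  · simpa using! lt_of_le_of_lt (le_add_of_nonneg_left (sq_nonneg (y 0))) hy

theorem fderiv_normSq_single {g : (Fin 2 → ℝ) → ℂ} (hg : ContDiff ℝ 1 g) (j : Fin 2)
    (y : Fin 2 → ℝ) :
    fderiv ℝ (fun y => ‖g y‖ ^ 2) y (Pi.single j 1) = 2 * (pd2 g j y * star (g y)).re := by
  have h := ((hg.differentiable one_ne_zero) y).hasFDerivAt.norm_sq
  rw [h.fderiv, pd2]
  simp [real_inner_eq_re_inner]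
  ring

/-- A trace-type estimate: the flux of `|g|² y` out of the disk is controlled from outside. -/
theorem exists_trace_bound {r : ℝ} (hr : 0 < r) (hr' : r < 1 / 2) :
    ∃ K, 0 ≤ K ∧ ∀ g : (Fin 2 → ℝ) → ℂ, ContDiff ℝ 1 g →
      ∫ y in Bset r, (2 * ‖g y‖ ^ 2 + 2 * (y 0 * (pd2 g 0 y * star (g y)).re +
          y 1 * (pd2 g 1 y * star (g y)).re)) ≤
        K * ∫ y in cell2 \ Bset r, (‖g y‖ ^ 2 + (‖pd2 g 0 y‖ ^ 2 + ‖pd2 g 1 y‖ ^ 2)) := by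
  let χ : ContDiffBump (0 : Fin 2 → ℝ) := ⟨r, (r + 1 / 2) / 2, hr, by linarith⟩
  let F : Fin 2 → (Fin 2 → ℝ) → ℝ := fun j y => χ y * y j
  have hF : ∀ j, ContDiff ℝ 1 (F j) := fun j => χ.contDiff.mul (by fun_prop)
  have hFc : ∀ j, HasCompactSupport (F j) := fun j => χ.hasCompactSupport.mul_right
  have hFd : ∀ j, Continuous fun y => fderiv ℝ (F j) y (Pi.single j 1) := fun j =>
    ((hF j).continuous_fderiv one_ne_zero).clm_apply continuous_const
  have hFdc : ∀ j, HasCompactSupport fun y => fderiv ℝ (F j) y (Pi.single j 1) := fun j =>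
    (hFc j).fderiv_apply ℝ _
  obtain ⟨M, hM⟩ : ∃ M, ∀ j y, |F j y| ≤ M := by
    have h := fun j => (hF j).continuous.bounded_above_of_compact_support (hFc j)
    choose m hm using h
    exact ⟨max (m 0) (m 1), fun j y => by
      fin_cases j
      · exact (hm 0 y).trans (le_max_left _ _)
      · exact (hm 1 y).trans (le_max_right _ _)⟩
  obtain ⟨M', hM'⟩ : ∃ M', ∀ j y, |fderiv ℝ (F j) y (Pi.single j 1)| ≤ M' := by
    have h := fun j => (hFd j).bounded_above_of_compact_support (hFdc j)
    choose m hm using h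
    exact ⟨max (m 0) (m 1), fun j y => by
      fin_cases j
      · exact (hm 0 y).trans (le_max_left _ _)
      · exact (hm 1 y).trans (le_max_right _ _)⟩
  have hM0 : 0 ≤ M := (abs_nonneg _).trans (hM 0 0)
  have hM0' : 0 ≤ M' := (abs_nonneg _).trans (hM' 0 0)
  have hFB : ∀ j, ∀ y ∈ Bset r, F j y = y j ∧ fderiv ℝ (F j) y (Pi.single j 1) = 1 := by
    intro j y hy
    have hone : ∀ x ∈ Bset r, F j x = x j := fun x hx => by
      simp only [F]
      rw [χ.one_of_mem_closedBall (Metric.ball_subset_closedBall (Bset_subset_ball hr hx)), one_mul]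
    refine ⟨hone y hy, ?_⟩
    have : F j =ᶠ[nhds y] (ContinuousLinearMap.proj (R := ℝ) (φ := fun _ : Fin 2 => ℝ) j) := by
      filter_upwards [(isOpen_Bset r).mem_nhds hy] with x hx using hone x hx
    rw [this.fderiv_eq, ContinuousLinearMap.fderiv]
    simp
  have hzero : ∀ y ∉ cell2, ∀ j, F j y = 0 ∧ fderiv ℝ (F j) y (Pi.single j 1) = 0 := by
    intro y hy j
    have h1 : tsupport (F j) ⊆ cell2 :=
      ((tsupport_mul_subset_left).trans χ.tsupport_eq.subset).trans
        (closedBall_subset_cell2 (by simp only [χ]; linarith))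
    refine ⟨image_eq_zero_of_notMem_tsupport fun h => hy (h1 h), ?_⟩
    exact image_eq_zero_of_notMem_tsupport (f := fun y => fderiv ℝ (F j) y (Pi.single j 1))
      fun h => hy (h1 (tsupport_fderiv_apply_subset ℝ (Pi.single j 1) h))
  refine ⟨2 * M + 2 * M', by positivity, fun g hg => ?_⟩
  set G : (Fin 2 → ℝ) → ℝ := fun y => ‖g y‖ ^ 2 with hGdef
  have hG : ContDiff ℝ 1 G := hg.norm_sq ℝ
  have hGd : ∀ j, Continuous fun y => fderiv ℝ G y (Pi.single j 1) := fun j =>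
    (hG.continuous_fderiv one_ne_zero).clm_apply continuous_const
  have hGc := hG.continuous
  have hibp : ∀ j, ∫ y, (F j y * fderiv ℝ G y (Pi.single j 1) +
      fderiv ℝ (F j) y (Pi.single j 1) * G y) = 0 := by
    intro j
    have i1 : Integrable fun y => F j y * fderiv ℝ G y (Pi.single j 1) :=
      ((hF j).continuous.mul (hGd j)).integrable_of_hasCompactSupport (hFc j).mul_right
    have i2 : Integrable fun y => fderiv ℝ (F j) y (Pi.single j 1) * G y :=
      ((hFd j).mul hGc).integrable_of_hasCompactSupport (hFdc j).mul_right
    have i3 : Integrable fun y => F j y * G y :=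
      ((hF j).continuous.mul hGc).integrable_of_hasCompactSupport (hFc j).mul_right
    rw [integral_add i1 i2, integral_mul_fderiv_eq_neg_fderiv_mul_of_integrable i2 i1 i3
      (fun x _ => (hF j).differentiable one_ne_zero x)
      (fun x _ => hG.differentiable one_ne_zero x), neg_add_cancel]
  set P : (Fin 2 → ℝ) → ℝ := fun y =>
    (F 0 y * fderiv ℝ G y (Pi.single 0 1) + fderiv ℝ (F 0) y (Pi.single 0 1) * G y) +
    (F 1 y * fderiv ℝ G y (Pi.single 1 1) + fderiv ℝ (F 1) y (Pi.single 1 1) * G y) with hP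
  have hPj : ∀ j, Continuous fun y => (F j y * fderiv ℝ G y (Pi.single j 1) +
      fderiv ℝ (F j) y (Pi.single j 1) * G y) := fun j =>
    ((hF j).continuous.mul (hGd j)).add ((hFd j).mul hGc)
  have hPc : Continuous P := (hPj 0).add (hPj 1)
  have hPint : ∫ y in cell2, P y = 0 := by
    have hz : ∀ j, ∀ y, y ∉ cell2 → (F j y * fderiv ℝ G y (Pi.single j 1) +
      fderiv ℝ (F j) y (Pi.single j 1) * G y) = 0 := fun j y hy => by
        rw [(hzero y hy j).1, (hzero y hy j).2, zero_mul, zero_mul, add_zero]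
    rw [hP, integral_add (hPj 0).integrableOn_cell2 (hPj 1).integrableOn_cell2,
      setIntegral_eq_integral_of_forall_compl_eq_zero (hz 0),
      setIntegral_eq_integral_of_forall_compl_eq_zero (hz 1), hibp, hibp, add_zero]
  have hsplit := integral_inter_add_sdiff (measurableSet_Bset r) hPc.integrableOn_cell2
  rw [Set.inter_eq_self_of_subset_right (Bset_subset_cell2 hr hr'), hPint] at hsplit
  have hB : ∫ y in Bset r, (2 * ‖g y‖ ^ 2 + 2 * (y 0 * (pd2 g 0 y * star (g y)).re +
      y 1 * (pd2 g 1 y * star (g y)).re)) = ∫ y in Bset r, P y := by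
    refine setIntegral_congr_fun (measurableSet_Bset r) fun y hy => ?_
    simp only [hP, hGdef, fderiv_normSq_single hg, (hFB 0 y hy).1, (hFB 1 y hy).1,
      (hFB 0 y hy).2, (hFB 1 y hy).2]
    ring
  rw [hB, eq_neg_of_add_eq_zero_left hsplit, ← integral_neg, ← integral_const_mul]
  have hcg := continuous_pd2 hg
  have hcg' := hg.continuous
  refine setIntegral_mono_on (hPc.neg.integrableOn_cell2.mono_set Set.sdiff_subset)
    (Continuous.integrableOn_cell2 (by fun_prop) |>.mono_set Set.sdiff_subset)
    (measurableSet_cell2.diff (measurableSet_Bset r)) fun y _ => ?_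
  have hre : ∀ j, |(pd2 g j y * star (g y)).re| ≤ ‖pd2 g j y‖ * ‖g y‖ := fun j => by
    refine (Complex.abs_re_le_norm _).trans ?_
    rw [norm_mul, norm_star]
  have hb : ∀ j, -(F j y * fderiv ℝ G y (Pi.single j 1) +
      fderiv ℝ (F j) y (Pi.single j 1) * G y) ≤
      M * (‖pd2 g j y‖ ^ 2 + ‖g y‖ ^ 2) + M' * ‖g y‖ ^ 2 := by
    intro j
    rw [neg_add]
    refine add_le_add ?_ ?_
    · refine (neg_le_abs _).trans ?_
      rw [abs_mul]
      refine mul_le_mul (hM j y) ?_ (abs_nonneg _) hM0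
      rw [hGdef, fderiv_normSq_single hg, abs_mul, abs_two]
      nlinarith [hre j, sq_nonneg (‖pd2 g j y‖ - ‖g y‖)]
    · refine (neg_le_abs _).trans ?_
      rw [abs_mul, abs_of_nonneg (sq_nonneg ‖g y‖)]
      exact mul_le_mul_of_nonneg_right (hM' j y) (sq_nonneg _)
  have h0 := hb 0
  have h1 := hb 1
  simp only [hP]
  nlinarith [mul_nonneg hM0' (sq_nonneg ‖pd2 g 0 y‖), mul_nonneg hM0' (sq_nonneg ‖pd2 g 1 y‖),
    mul_nonneg hM0 (sq_nonneg ‖pd2 g 0 y‖), mul_nonneg hM0 (sq_nonneg ‖pd2 g 1 y‖)]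

theorem indicator_outSet_eq {r : ℝ} (hr : 0 < r) (hr' : r < 1 / 2) (f : (Fin 2 → ℝ) → ℝ) :
    ∫ y in cell2, (outSet r).indicator f y = ∫ y in cell2 \ Bset r, f y := by
  rw [setIntegral_indicator (measurableSet_outSet r)]
  congr 2
  ext y
  refine and_congr_right fun hy => ⟨fun h hB => ?_, fun h m => ?_⟩
  · have := h 0
    simp only [Bset, Set.mem_ofPred_eq] at hB
    simp at this
    linarith
  · simp only [Bset, Set.mem_ofPred_eq, not_lt] at h
    have hfar : ∀ i, m i ≠ 0 → r ^ 2 ≤ (y i - m i) ^ 2 := by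
      intro i hi
      have hyi := hy i trivial
      rcases lt_or_gt_of_ne hi with h1 | h1
      · have : (m i : ℝ) ≤ -1 := by exact_mod_cast Int.le_sub_one_of_lt h1
        nlinarith [hyi.1]
      · have : (1 : ℝ) ≤ m i := by exact_mod_cast h1
        nlinarith [hyi.2]
    by_cases h0 : m 0 = 0
    · by_cases h1 : m 1 = 0
      · simpa [h0, h1] using h
      · have := hfar 1 h1
        nlinarith [sq_nonneg (y 0 - m 0)]
    · have := hfar 0 h0
      nlinarith [sq_nonneg (y 1 - m 1)]

theorem volume_real_cell2 : volume.real cell2 = 1 := by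
  rw [cell2, measureReal_def, volume_pi_pi]
  norm_num

theorem volume_real_restrict_le {S : Set (Fin 2 → ℝ)} (hS : S ⊆ cell2) :
    (volume.restrict S).real Set.univ ≤ 1 := by
  rw [measureReal_restrict_apply_univ, ← volume_real_cell2]
  refine measureReal_mono hS ?_
  rw [cell2, volume_pi_pi]
  norm_num

theorem isFiniteMeasure_restrict_of_subset {S : Set (Fin 2 → ℝ)} (hS : S ⊆ cell2) :
    IsFiniteMeasure (volume.restrict S) := by
  refine ⟨?_⟩
  rw [Measure.restrict_apply_univ]
  refine (measure_mono hS).trans_lt ?_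
  rw [cell2, volume_pi_pi]
  norm_num

theorem setIntegral_norm_sq_le {S : Set (Fin 2 → ℝ)} (hS : S ⊆ cell2) {g : (Fin 2 → ℝ) → ℂ}
    (hg : Continuous g) : (∫ y in S, ‖g y‖) ^ 2 ≤ ∫ y in S, ‖g y‖ ^ 2 := by
  have := isFiniteMeasure_restrict_of_subset hS
  have h := norm_integral_sq_le (f := fun y => ((‖g y‖ : ℝ) : ℂ)) (volume_real_restrict_le hS)
    ((Continuous.integrableOn_cell2 (by fun_prop)).mono_set hS)
    ((Continuous.integrableOn_cell2 (by fun_prop)).mono_set hS)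
  rw [integral_complex_ofReal] at h
  simpa using h

theorem two_mul_setIntegral_norm_sq_le {W : (Fin 2 → ℝ) → ℂ} {r : ℝ} (hr : 0 < r)
    (hr' : r < 1 / 2) (hW : ContDiff ℝ 1 W) {c : ℂ} {T : ℝ}
    (hT : ∫ y in Bset r, (2 * ‖W y - c‖ ^ 2 + 2 * (y 0 * (pd2 W 0 y * star (W y - c)).re +
      y 1 * (pd2 W 1 y * star (W y - c)).re)) ≤ T)
    (hvir : ∫ y in Bset r, ((r ^ 2 - (y 0 ^ 2 + y 1 ^ 2)) / 2 *
        (‖pd2 W 0 y‖ ^ 2 + ‖pd2 W 1 y‖ ^ 2 + (W y * star (W y - c)).re) -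
      (y 0 * (pd2 W 0 y * star (W y - c)).re + y 1 * (pd2 W 1 y * star (W y - c)).re)) = 0) :
    2 * ∫ y in Bset r, ‖W y - c‖ ^ 2 ≤ T + 1 / 4 * (‖c‖ * ∫ y in Bset r, ‖W y - c‖) := by
  have hcW := continuous_pd2 hW
  have hcW' := hW.continuous
  have hsB := Bset_subset_cell2 hr hr'
  have hintB : ∀ {F : Type} [NormedAddCommGroup F] [NormedSpace ℝ F] {G : (Fin 2 → ℝ) → F},
      Continuous G → IntegrableOn G (Bset r) := fun hG => hG.integrableOn_cell2.mono_set hsB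
  have hle : ∫ y in Bset r, (2 * ‖W y - c‖ ^ 2 - 1 / 4 * (‖c‖ * ‖W y - c‖)) ≤
      ∫ y in Bset r, ((2 * ‖W y - c‖ ^ 2 + 2 * (y 0 * (pd2 W 0 y * star (W y - c)).re +
        y 1 * (pd2 W 1 y * star (W y - c)).re)) + 2 *
        ((r ^ 2 - (y 0 ^ 2 + y 1 ^ 2)) / 2 *
          (‖pd2 W 0 y‖ ^ 2 + ‖pd2 W 1 y‖ ^ 2 + (W y * star (W y - c)).re) -
        (y 0 * (pd2 W 0 y * star (W y - c)).re + y 1 * (pd2 W 1 y * star (W y - c)).re))) := by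
    refine setIntegral_mono_on (hintB (by fun_prop)) (hintB ?_) (measurableSet_Bset r)
      fun y hy => ?_
    · have : Continuous fun y => (W y * star (W y - c)).re := by fun_prop
      have : ∀ j, Continuous fun y => (pd2 W j y * star (W y - c)).re := fun j => by fun_prop
      fun_prop
    · simp only [Bset, Set.mem_ofPred_eq] at hy
      have h1 : (W y * star (W y - c)).re = ‖W y - c‖ ^ 2 + (c * star (W y - c)).re := by
        rw [← Complex.normSq_eq_norm_sq]
        simp [Complex.normSq_apply]
        ring
      have h2 : -(‖c‖ * ‖W y - c‖) ≤ (c * star (W y - c)).re := by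
        have := (abs_le.1 (Complex.abs_re_le_norm (c * star (W y - c)))).1
        rwa [norm_mul, norm_star] at this
      rw [h1]
      set s := r ^ 2 - (y 0 ^ 2 + y 1 ^ 2) with hs
      have hs0 : 0 ≤ s := by linarith
      have hs1 : s ≤ 1 / 4 := by nlinarith [sq_nonneg (y 0), sq_nonneg (y 1)]
      have hn : 0 ≤ ‖c‖ * ‖W y - c‖ := by positivity
      nlinarith [mul_le_mul_of_nonneg_left h2 hs0, mul_le_mul_of_nonneg_right hs1 hn,
        mul_nonneg hs0 (sq_nonneg ‖pd2 W 0 y‖), mul_nonneg hs0 (sq_nonneg ‖pd2 W 1 y‖),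
        mul_nonneg hs0 (sq_nonneg ‖W y - c‖)]
  have c1 : Continuous fun y => (W y * star (W y - c)).re := by fun_prop
  have c2 : ∀ j, Continuous fun y => (pd2 W j y * star (W y - c)).re := fun j => by fun_prop
  rw [integral_add (hintB (by fun_prop)) (hintB (by fun_prop)), integral_const_mul, hvir,
    integral_sub (hintB (by fun_prop)) (hintB (by fun_prop)), integral_const_mul,
    integral_const_mul, integral_const_mul] at hle
  linarith

/-- The two-dimensional gap: a mean-free `W`, weakly solving `-ΔW + W = 0` in the disk, is
controlled by its quasi-periodic energy outside the disk. -/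
theorem exists_planar_gap {r : ℝ} (hr : 0 < r) (hr' : r < 1 / 2) :
    ∃ C > 0, ∀ θ : Fin 2 → ℝ, (∀ j, |θ j| ≤ Real.pi) →
      ∀ W : (Fin 2 → ℝ) → ℂ, ContDiff ℝ 1 W →
        (∀ (y : Fin 2 → ℝ) (m : Fin 2 → ℤ), W (y + fun i => (m i : ℝ)) = W y) →
        ∫ y in cell2, W y = 0 →
        (∀ ζ : (Fin 2 → ℝ) → ℂ, ContDiff ℝ (⊤ : ℕ∞) ζ → HasCompactSupport ζ →
          tsupport ζ ⊆ Bset r → ∫ y in Bset r, pairing W ζ y = 0) →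
        ∫ y in cell2, ‖W y‖ ^ 2 ≤
          C * ∫ y in cell2, (outSet r).indicator (energyDensity θ W) y := by
  obtain ⟨C, hC, hP⟩ := exists_poincare_outSet hr hr'
  obtain ⟨K, hK, hT⟩ := exists_trace_bound hr hr'
  refine ⟨6 * (K + 2) * C, by positivity, fun θ hθ W hW hper hmean hweak => ?_⟩
  obtain ⟨c, hc⟩ := hP θ hθ W hW hper
  set e := C * ∫ y in cell2, (outSet r).indicator (energyDensity θ W) y with he
  rw [indicator_outSet_eq hr hr'] at hc
  have hg : ContDiff ℝ 1 (fun y => W y - c) := hW.sub contDiff_const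
  have hpg : ∀ j, pd2 (fun y => W y - c) j = pd2 W j := fun j => by
    ext y; simp only [pd2, fderiv_sub_const]
  have hcW := continuous_pd2 hW
  have hcW' := hW.continuous
  have hsB := Bset_subset_cell2 hr hr'
  have hintB : ∀ {F : Type} [NormedAddCommGroup F] [NormedSpace ℝ F] {G : (Fin 2 → ℝ) → F},
      Continuous G → IntegrableOn G (Bset r) := fun hG => hG.integrableOn_cell2.mono_set hsB
  have hintO : ∀ {F : Type} [NormedAddCommGroup F] [NormedSpace ℝ F] {G : (Fin 2 → ℝ) → F},
      Continuous G → IntegrableOn G (cell2 \ Bset r) := fun hG =>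
    hG.integrableOn_cell2.mono_set Set.sdiff_subset
  have hsplit : ∀ {G : (Fin 2 → ℝ) → ℝ}, Continuous G →
      ∫ y in cell2, G y = (∫ y in Bset r, G y) + ∫ y in cell2 \ Bset r, G y := fun hG => by
    rw [← integral_inter_add_sdiff (measurableSet_Bset r) hG.integrableOn_cell2,
      Set.inter_eq_self_of_subset_right hsB]
  have hed : ∀ y, energyDensity 0 W y = ‖pd2 W 0 y‖ ^ 2 + ‖pd2 W 1 y‖ ^ 2 := fun y => by
    simp [energyDensity, Fin.sum_univ_two]
  have hO : ∫ y in cell2 \ Bset r, ‖W y - c‖ ^ 2 ≤ e := by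
    refine le_trans (integral_mono (hintO (by fun_prop))
      (hintO (by have := continuous_energyDensity (θ := 0) hW; fun_prop)) fun y => ?_) hc
    exact le_add_of_nonneg_right (energyDensity_nonneg _ _ _)
  have htr := hT _ hg
  simp only [hpg] at htr
  simp only [hed] at hc
  have htr' := htr.trans (mul_le_mul_of_nonneg_left hc hK)
  have hvir := virial_identity hr hr' hW (fun z hz hzc hzS =>
    pairing_eq_zero_of_smooth hr hr' hW hweak hz hzc hzS) c
  set X := ∫ y in Bset r, ‖W y - c‖ ^ 2 with hX
  set p := ∫ y in Bset r, ‖W y - c‖ with hp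
  set o := ∫ y in cell2 \ Bset r, ‖W y - c‖ with ho
  set E := ∫ y in cell2 \ Bset r, ‖W y - c‖ ^ 2 with hE
  have hp0 : 0 ≤ p := integral_nonneg fun y => norm_nonneg _
  have ho0 : 0 ≤ o := integral_nonneg fun y => norm_nonneg _
  have hpX : p ^ 2 ≤ X := setIntegral_norm_sq_le hsB hg.continuous
  have hoE : o ^ 2 ≤ E := setIntegral_norm_sq_le Set.sdiff_subset hg.continuous
  have hcn : ‖c‖ ≤ p + o := by
    have h1 : ∫ y in cell2, (W y - c) = -c := by
      rw [integral_sub hcW'.integrableOn_cell2 (continuous_const.integrableOn_cell2), hmean,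
        setIntegral_const, volume_real_cell2, one_smul, zero_sub]
    rw [← norm_neg, ← h1, hp, ho, ← hsplit (by fun_prop)]
    exact norm_integral_le_integral_norm _
  have hXc : 2 * X ≤ K * e + 1 / 4 * (‖c‖ * p) :=
    two_mul_setIntegral_norm_sq_le hr hr' hW htr' hvir
  have hX0 : 0 ≤ X := (sq_nonneg p).trans hpX
  have hE0 : 0 ≤ E := (sq_nonneg o).trans hoE
  have hcp : ‖c‖ * p ≤ 3 / 2 * X + 1 / 2 * e := by
    nlinarith [mul_le_mul_of_nonneg_right hcn hp0, sq_nonneg (p - o)]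
  have hXe : X ≤ (K + 1) * e := by nlinarith
  have hc2 : ‖c‖ ^ 2 ≤ 2 * X + 2 * e := by
    nlinarith [mul_self_le_mul_self (norm_nonneg c) hcn, sq_nonneg (p - o)]
  calc ∫ y in cell2, ‖W y‖ ^ 2 ≤ ∫ y in cell2, (2 * ‖W y - c‖ ^ 2 + 2 * ‖c‖ ^ 2) := by
        refine integral_mono (Continuous.integrableOn_cell2 (by fun_prop))
          (Continuous.integrableOn_cell2 (by fun_prop)) fun y => ?_
        have := norm_add_le (W y - c) c
        rw [sub_add_cancel] at this
        have h2 := mul_self_le_mul_self (norm_nonneg _) this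
        nlinarith [sq_nonneg (‖W y - c‖ - ‖c‖)]
    _ = 2 * (X + E) + 2 * ‖c‖ ^ 2 := by
        rw [integral_add (Continuous.integrableOn_cell2 (by fun_prop))
          (Continuous.integrableOn_cell2 (by fun_prop)), setIntegral_const, volume_real_cell2,
          one_smul, integral_const_mul, hsplit (by fun_prop)]
    _ ≤ 6 * (K + 2) * e := by nlinarith
    _ = _ := by rw [he]; ring

/-- The point of `ℝ³` with horizontal part `y` and height `t`. -/
def lift3 (y : Fin 2 → ℝ) (t : ℝ) : Fin 3 → ℝ := ![y 0, y 1, t]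

theorem low_lift3 (y : Fin 2 → ℝ) (t : ℝ) : low (lift3 y t) = y := by
  ext i; fin_cases i <;> rfl

theorem lift3_two (y : Fin 2 → ℝ) (t : ℝ) : lift3 y t 2 = t := rfl

theorem continuous_lift3 : Continuous fun p : (Fin 2 → ℝ) × ℝ => lift3 p.1 p.2 := by
  refine continuous_pi fun i => ?_
  fin_cases i
  · exact (continuous_apply (0 : Fin 2)).comp' continuous_fst
  · exact (continuous_apply (1 : Fin 2)).comp' continuous_fst
  · exact continuous_snd

theorem continuous_low : Continuous low := continuous_pi fun _ => continuous_apply _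

/-- The cylinder of unit height over `S`. -/
def tube (S : Set (Fin 2 → ℝ)) : Set (Fin 3 → ℝ) :=
  {x | low x ∈ S ∧ x 2 ∈ Set.Ico (-(1 : ℝ) / 2) (1 / 2)}

theorem cell_eq_tube : cell = tube cell2 := by
  ext x
  simp [cell, tube, cell2, low, Set.mem_pi, Fin.forall_fin_succ, and_assoc]

theorem fiberCell_eq_tube (r : ℝ) : fiberCell r = tube (Bset r) := rfl

theorem piFinSuccAbove_symm_eq (p : ℝ × (Fin 2 → ℝ)) :
    (MeasurableEquiv.piFinSuccAbove (fun _ : Fin 3 => ℝ) 2).symm p = lift3 p.2 p.1 := by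
  ext i
  fin_cases i <;> rfl

theorem piFinSuccAbove_symm_preimage_tube (S : Set (Fin 2 → ℝ)) :
    (MeasurableEquiv.piFinSuccAbove (fun _ : Fin 3 => ℝ) 2).symm ⁻¹' tube S =
      Set.Ico (-(1 : ℝ) / 2) (1 / 2) ×ˢ S := by
  ext p
  rw [Set.mem_preimage, piFinSuccAbove_symm_eq]
  simp only [tube, Set.mem_ofPred_eq, low_lift3, lift3_two, Set.mem_prod]
  exact and_comm

theorem integrable_prod_of_tube {F : Type*} [NormedAddCommGroup F] {f : (Fin 3 → ℝ) → F}
    {S : Set (Fin 2 → ℝ)} (hf : IntegrableOn f (tube S)) :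
    Integrable (fun p : (Fin 2 → ℝ) × ℝ => f (lift3 p.1 p.2))
      ((volume.restrict S).prod (volume.restrict (Set.Ico (-(1 : ℝ) / 2) (1 / 2)))) := by
  have hmp := (volume_preserving_piFinSuccAbove (fun _ : Fin 3 => ℝ) 2).symm
  have h := (hmp.integrableOn_comp_preimage
    (MeasurableEquiv.measurableEmbedding _) (f := f) (s := tube S)).2 hf
  rw [piFinSuccAbove_symm_preimage_tube, IntegrableOn, Measure.volume_eq_prod,
    ← Measure.prod_restrict] at h
  have h2 := h.swap
  refine h2.congr (Filter.Eventually.of_forall fun p => ?_)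
  simp only [Function.comp, piFinSuccAbove_symm_eq, Prod.swap]

theorem setIntegral_tube {F : Type*} [NormedAddCommGroup F] [NormedSpace ℝ F]
    {f : (Fin 3 → ℝ) → F} {S : Set (Fin 2 → ℝ)} (hf : IntegrableOn f (tube S)) :
    ∫ x in tube S, f x =
      ∫ y in S, ∫ t in Set.Ico (-(1 : ℝ) / 2) (1 / 2), f (lift3 y t) := by
  have hmp := (volume_preserving_piFinSuccAbove (fun _ : Fin 3 => ℝ) 2).symm
  have h := hmp.setIntegral_preimage_emb (MeasurableEquiv.measurableEmbedding _) f (tube S)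
  rw [← h, piFinSuccAbove_symm_preimage_tube, Measure.volume_eq_prod,
    ← Measure.prod_restrict, ← integral_prod_swap]
  simp only [piFinSuccAbove_symm_eq, Prod.swap]
  exact integral_prod _ (integrable_prod_of_tube hf)

theorem Continuous.integrableOn_tube {F : Type*} [NormedAddCommGroup F]
    {f : (Fin 3 → ℝ) → F} {S : Set (Fin 2 → ℝ)} (hf : Continuous f) (hS : S ⊆ cell2) :
    IntegrableOn f (tube S) := by
  have : tube S ⊆ Set.Icc (fun _ => -(1 : ℝ) / 2) (fun _ => 1 / 2) := by
    have h : tube S ⊆ cell := by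
      rw [cell_eq_tube]; exact fun x hx => ⟨hS hx.1, hx.2⟩
    exact fun x hx => ⟨fun i => (h hx i trivial).1, fun i => (h hx i trivial).2.le⟩
  exact hf.integrableOn_Icc.mono_set this

/-- The vertical average of a function on `ℝ³`. -/
noncomputable def vavg (w : (Fin 3 → ℝ) → ℂ) (y : Fin 2 → ℝ) : ℂ :=
  ∫ t in Set.Ico (-(1 : ℝ) / 2) (1 / 2), w (lift3 y t)

/-- The linear part of `y ↦ lift3 y t`. -/
noncomputable def embed3 : (Fin 2 → ℝ) →L[ℝ] (Fin 3 → ℝ) :=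
  LinearMap.toContinuousLinearMap
    { toFun := fun y => lift3 y 0
      map_add' := fun x y => by ext i; fin_cases i <;> simp [lift3]
      map_smul' := fun c y => by ext i; fin_cases i <;> simp [lift3] }

theorem hasFDerivAt_lift3 (t : ℝ) (y : Fin 2 → ℝ) :
    HasFDerivAt (fun y => lift3 y t) embed3 y := by
  have h : (fun y => lift3 y t) = fun y => embed3 y + ![0, 0, t] := by
    ext y i
    fin_cases i <;> simp [embed3, lift3]
  rw [h]
  exact embed3.hasFDerivAt.add_const _

theorem embed3_single (j : Fin 2) : embed3 (Pi.single j 1) = Pi.single j.castSucc 1 := by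
  ext i
  fin_cases j <;> fin_cases i <;> simp [embed3, lift3]

theorem hasFDerivAt_vavg {w : (Fin 3 → ℝ) → ℂ} (hw : ContDiff ℝ 1 w) (y : Fin 2 → ℝ) :
    HasFDerivAt (vavg w)
      (∫ t in Set.Ico (-(1 : ℝ) / 2) (1 / 2), (fderiv ℝ w (lift3 y t)).comp embed3) y := by
  have hcd : Continuous fun p : (Fin 2 → ℝ) × ℝ => (fderiv ℝ w (lift3 p.1 p.2)).comp embed3 :=
    ((hw.continuous_fderiv one_ne_zero).comp continuous_lift3).clm_comp continuous_const
  have hcw : Continuous fun p : (Fin 2 → ℝ) × ℝ => w (lift3 p.1 p.2) :=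
    hw.continuous.comp continuous_lift3
  obtain ⟨M, hM⟩ := ((isCompact_closedBall y 1).prod
    (isCompact_Icc (a := -(1 : ℝ) / 2) (b := 1 / 2))).exists_bound_of_continuousOn hcd.continuousOn
  refine hasFDerivAt_integral_of_dominated_of_fderiv_le (𝕜 := ℝ)
    (F' := fun y t => (fderiv ℝ w (lift3 y t)).comp embed3) (bound := fun _ => M)
    (Metric.ball_mem_nhds y one_pos) ?_ ?_ ?_ ?_ ?_ ?_
  · exact Filter.Eventually.of_forall fun x =>
      (hcw.comp (Continuous.prodMk_right x)).aestronglyMeasurable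
  · exact (hcw.comp (Continuous.prodMk_right y)).integrableOn_Icc.mono_set Set.Ico_subset_Icc_self
  · exact (hcd.comp (Continuous.prodMk_right y)).aestronglyMeasurable
  · refine (ae_restrict_iff' measurableSet_Ico).2 (Filter.Eventually.of_forall fun t ht x hx => ?_)
    exact hM (x, t) ⟨Metric.ball_subset_closedBall hx, Set.Ico_subset_Icc_self ht⟩
  · exact integrable_const _
  · refine Filter.Eventually.of_forall fun t x _ => ?_
    exact ((hw.differentiable one_ne_zero) _).hasFDerivAt.comp x (hasFDerivAt_lift3 t x)

theorem contDiff_vavg {w : (Fin 3 → ℝ) → ℂ} (hw : ContDiff ℝ 1 w) : ContDiff ℝ 1 (vavg w) := by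
  refine contDiff_one_iff_hasFDerivAt.2 ⟨_, ?_, hasFDerivAt_vavg hw⟩
  simp_rw [← integral_Icc_eq_integral_Ico]
  exact continuous_parametric_integral_of_continuous
    (f := fun y t => (fderiv ℝ w (lift3 y t)).comp embed3)
    (((hw.continuous_fderiv one_ne_zero).comp continuous_lift3).clm_comp continuous_const)
    isCompact_Icc

theorem pd2_vavg {w : (Fin 3 → ℝ) → ℂ} (hw : ContDiff ℝ 1 w) (j : Fin 2) (y : Fin 2 → ℝ) :
    pd2 (vavg w) j y = vavg (pd3 w j.castSucc) y := by
  have hcd : Continuous fun t => (fderiv ℝ w (lift3 y t)).comp embed3 :=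
    (((hw.continuous_fderiv one_ne_zero).comp continuous_lift3).clm_comp
      continuous_const).comp (Continuous.prodMk_right y)
  rw [pd2, (hasFDerivAt_vavg hw y).fderiv, ContinuousLinearMap.integral_apply
    (hcd.integrableOn_Icc.mono_set Set.Ico_subset_Icc_self)]
  simp only [vavg, pd3, ContinuousLinearMap.comp_apply, embed3_single]

theorem volume_real_restrict_Ico :
    (volume.restrict (Set.Ico (-(1 : ℝ) / 2) (1 / 2))).real Set.univ = 1 := by
  rw [measureReal_restrict_apply_univ, Real.volume_real_Ico]
  norm_num

theorem Continuous.integrableOn_lift3 {F : Type*} [NormedAddCommGroup F] {f : (Fin 3 → ℝ) → F}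
    (hf : Continuous f) (y : Fin 2 → ℝ) :
    IntegrableOn (fun t => f (lift3 y t)) (Set.Ico (-(1 : ℝ) / 2) (1 / 2)) :=
  ((hf.comp continuous_lift3).comp (Continuous.prodMk_right y)).integrableOn_Icc.mono_set
    Set.Ico_subset_Icc_self

theorem vavg_periodic {w : (Fin 3 → ℝ) → ℂ}
    (hp : ∀ (y : Fin 3 → ℝ) (m : Fin 3 → ℤ), w (y + fun i => (m i : ℝ)) = w y)
    (y : Fin 2 → ℝ) (m : Fin 2 → ℤ) : vavg w (y + fun i => (m i : ℝ)) = vavg w y := by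
  have h : ∀ t, lift3 (y + fun i => (m i : ℝ)) t =
      lift3 y t + fun i => ((![m 0, m 1, 0] i : ℤ) : ℝ) := fun t => by
    ext i; fin_cases i <;> simp [lift3]
  simp only [vavg, h, hp]

theorem pairing_vavg {w : (Fin 3 → ℝ) → ℂ} (hw : ContDiff ℝ 1 w) (ζ : (Fin 2 → ℝ) → ℂ)
    (y : Fin 2 → ℝ) :
    pairing (vavg w) ζ y = ∫ t in Set.Ico (-(1 : ℝ) / 2) (1 / 2),
      (pd3 w 0 (lift3 y t) * star (pd2 ζ 0 (low (lift3 y t))) +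
        pd3 w 1 (lift3 y t) * star (pd2 ζ 1 (low (lift3 y t))) +
        w (lift3 y t) * star (ζ (low (lift3 y t)))) := by
  have h0 := ((continuous_pd3 hw 0).integrableOn_lift3 y).mul_const (star (pd2 ζ 0 y))
  have h1 := ((continuous_pd3 hw 1).integrableOn_lift3 y).mul_const (star (pd2 ζ 1 y))
  have h2 := (hw.continuous.integrableOn_lift3 y).mul_const (star (ζ y))
  have h01 : Integrable (fun t => pd3 w 0 (lift3 y t) * star (pd2 ζ 0 y) +
      pd3 w 1 (lift3 y t) * star (pd2 ζ 1 y)) (volume.restrict (Set.Ico (-(1 : ℝ) / 2) (1 / 2))) :=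
    h0.add h1
  simp only [low_lift3]
  rw [integral_add h01 h2, integral_add h0 h1, integral_mul_const, integral_mul_const,
    integral_mul_const, pairing, pd2_vavg hw, pd2_vavg hw]
  rfl

theorem setIntegral_pairing_vavg {w : (Fin 3 → ℝ) → ℂ} (hw : ContDiff ℝ 1 w) {r : ℝ}
    (hr : 0 < r) (hr' : r < 1 / 2) {ζ : (Fin 2 → ℝ) → ℂ} (hζ : ContDiff ℝ 1 ζ) :
    ∫ y in Bset r, pairing (vavg w) ζ y = ∫ x in fiberCell r,
      (pd3 w 0 x * star (pd2 ζ 0 (low x)) + pd3 w 1 x * star (pd2 ζ 1 (low x)) +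
        w x * star (ζ (low x))) := by
  have h0 := continuous_pd3 hw
  have h1 := fun j => (continuous_pd2 hζ j).comp continuous_low
  have h2 := hζ.continuous.comp continuous_low
  have h3 := hw.continuous
  have hc : Continuous fun x => (pd3 w 0 x * star (pd2 ζ 0 (low x)) +
      pd3 w 1 x * star (pd2 ζ 1 (low x)) + w x * star (ζ (low x))) :=
    (((h0 0).mul (h1 0).star).add ((h0 1).mul (h1 1).star)).add (h3.mul h2.star)
  rw [fiberCell_eq_tube, setIntegral_tube (hc.integrableOn_tube (Bset_subset_cell2 hr hr'))]
  simp only [pairing_vavg hw]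

/-- The density `|∂_j w + i θ_j w|²`. -/
noncomputable def twistedSq (θ : Fin 3 → ℝ) (w : (Fin 3 → ℝ) → ℂ) (j : Fin 3) (x : Fin 3 → ℝ) : ℝ :=
  ‖pd3 w j x + Complex.I * (θ j : ℂ) * w x‖ ^ 2

theorem continuous_twistedSq {θ : Fin 3 → ℝ} {w : (Fin 3 → ℝ) → ℂ} (hw : ContDiff ℝ 1 w)
    (j : Fin 3) : Continuous (twistedSq θ w j) :=
  ((continuous_pd3 hw j).add (continuous_const.mul hw.continuous)).norm.pow 2

theorem twistedSq_nonneg (θ : Fin 3 → ℝ) (w : (Fin 3 → ℝ) → ℂ) (j : Fin 3) (x : Fin 3 → ℝ) :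
    0 ≤ twistedSq θ w j x := sq_nonneg _

theorem energyDensity_vavg_le {θ : Fin 3 → ℝ} {w : (Fin 3 → ℝ) → ℂ} (hw : ContDiff ℝ 1 w)
    (y : Fin 2 → ℝ) :
    energyDensity (fun j => θ j.castSucc) (vavg w) y ≤
      ∫ t in Set.Ico (-(1 : ℝ) / 2) (1 / 2),
        (twistedSq θ w 0 (lift3 y t) + twistedSq θ w 1 (lift3 y t)) := by
  have hb : ∀ j : Fin 2, ‖pd2 (vavg w) j y + Complex.I * (θ j.castSucc : ℂ) * vavg w y‖ ^ 2 ≤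
      ∫ t in Set.Ico (-(1 : ℝ) / 2) (1 / 2), twistedSq θ w j.castSucc (lift3 y t) := by
    intro j
    have i1 := (continuous_pd3 hw j.castSucc).integrableOn_lift3 y
    have i2 := (hw.continuous.integrableOn_lift3 y).const_mul (Complex.I * (θ j.castSucc : ℂ))
    rw [pd2_vavg hw, vavg, vavg, ← integral_const_mul, ← integral_add i1 i2]
    exact norm_integral_sq_le volume_real_restrict_Ico.le (i1.add i2)
      ((continuous_twistedSq hw j.castSucc).integrableOn_lift3 y)
  rw [integral_add ((continuous_twistedSq hw 0).integrableOn_lift3 y)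
    ((continuous_twistedSq hw 1).integrableOn_lift3 y), energyDensity, Fin.sum_univ_two]
  exact add_le_add (hb 0) (hb 1)

theorem lift3_eq_add_smul (y : Fin 2 → ℝ) (t : ℝ) :
    lift3 y t = lift3 y 0 + t • (Pi.single 2 1 : Fin 3 → ℝ) := by
  ext i; fin_cases i <;> simp [lift3]

theorem norm_sub_vavg_sq_le {θ : Fin 3 → ℝ} {w : (Fin 3 → ℝ) → ℂ} (hw : ContDiff ℝ 1 w)
    (hp : ∀ (y : Fin 3 → ℝ) (m : Fin 3 → ℤ), w (y + fun i => (m i : ℝ)) = w y)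
    (hθ : |θ 2| ≤ Real.pi) (y : Fin 2 → ℝ) {t : ℝ} (ht : t ∈ Set.Ico (-(1 : ℝ) / 2) (1 / 2)) :
    ‖w (lift3 y t) - vavg w y‖ ^ 2 ≤
      10 * ∫ u in Set.Ico (-(1 : ℝ) / 2) (1 / 2), twistedSq θ w 2 (lift3 y u) := by
  have hshift : ∀ u, lift3 y (u + 1) = lift3 y u + fun i => ((![0, 0, 1] i : ℤ) : ℝ) := fun u => by
    ext i; fin_cases i <;> simp [lift3]
  have hf : ∀ u, HasDerivAt (fun u => w (lift3 y u)) (pd3 w 2 (lift3 y u)) u := fun u => by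
    have hl : HasDerivAt (fun u : ℝ => lift3 y u) (Pi.single 2 1 : Fin 3 → ℝ) u := by
      rw [funext (lift3_eq_add_smul y)]
      simpa using ((hasDerivAt_id u).smul_const (Pi.single 2 1 : Fin 3 → ℝ)).const_add (lift3 y 0)
    exact ((hw.differentiable one_ne_zero) _).hasFDerivAt.comp_hasDerivAt u hl
  have hper : Function.Periodic (fun u => w (lift3 y u)) 1 := fun u => by
    simp only [hshift, hp]
  have hper' : Function.Periodic (fun u => pd3 w 2 (lift3 y u)) 1 := fun u => by
    simp only [hshift, pd3_periodic (fun x => hp x ![0, 0, 1])]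
  have hc : Continuous fun u => pd3 w 2 (lift3 y u) :=
    ((continuous_pd3 hw 2).comp continuous_lift3).comp (Continuous.prodMk_right y)
  have hpt : ∀ s ∈ Set.Ico (-(1 : ℝ) / 2) (1 / 2), ‖w (lift3 y t) - w (lift3 y s)‖ ^ 2 ≤
      10 * ∫ u in Set.Ico (-(1 : ℝ) / 2) (1 / 2), twistedSq θ w 2 (lift3 y u) := by
    intro s hs
    have h := norm_sub_sq_le_of_periodic hf hc hper hper' hθ (s := t) (t := s)
      (abs_le.2 ⟨by linarith [ht.1, hs.2], by linarith [ht.2, hs.1]⟩)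
    rwa [← setIntegral_Ico_eq_of_periodic (fun u => by
      have h1 := hper u
      have h2 := hper' u
      simp only at h1 h2 ⊢
      rw [h1, h2])] at h
  have hcw : Continuous fun x => w (lift3 y t) - w x := continuous_const.sub hw.continuous
  have e : w (lift3 y t) - vavg w y =
      ∫ s in Set.Ico (-(1 : ℝ) / 2) (1 / 2), (w (lift3 y t) - w (lift3 y s)) := by
    rw [integral_sub (integrable_const _) (hw.continuous.integrableOn_lift3 y), integral_const,
      volume_real_restrict_Ico, one_smul, vavg]
  rw [e]
  refine (norm_integral_sq_le volume_real_restrict_Ico.le (hcw.integrableOn_lift3 y)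
    ((hcw.norm.pow 2).integrableOn_lift3 y)).trans ?_
  refine (setIntegral_mono_on ((hcw.norm.pow 2).integrableOn_lift3 y) (integrable_const _)
    measurableSet_Ico hpt).trans_eq ?_
  rw [integral_const, volume_real_restrict_Ico, one_smul]

theorem setIntegral_norm_sq_le_twistedSq {θ : Fin 3 → ℝ} {w : (Fin 3 → ℝ) → ℂ}
    (hw : ContDiff ℝ 1 w)
    (hp : ∀ (y : Fin 3 → ℝ) (m : Fin 3 → ℤ), w (y + fun i => (m i : ℝ)) = w y)
    (hθ : |θ 2| ≤ Real.pi) :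
    ∫ x in cell, ‖w x‖ ^ 2 ≤
      20 * (∫ x in cell, twistedSq θ w 2 x) + 2 * ∫ y in cell2, ‖vavg w y‖ ^ 2 := by
  have i1 : IntegrableOn (fun x => ‖w x‖ ^ 2) (tube cell2) :=
    (hw.continuous.norm.pow 2).integrableOn_tube (subset_refl cell2)
  have i2 := (continuous_twistedSq (θ := θ) hw 2).integrableOn_tube (subset_refl cell2)
  have i3 : IntegrableOn (fun y => ‖vavg w y‖ ^ 2) cell2 :=
    ((contDiff_vavg hw).continuous.norm.pow 2).integrableOn_cell2
  have i4 := (integrable_prod_of_tube i2).integral_prod_left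
  rw [cell_eq_tube, setIntegral_tube i1, setIntegral_tube i2, ← integral_const_mul,
    ← integral_const_mul, ← integral_add (i4.const_mul 20) (i3.const_mul 2)]
  refine integral_mono (integrable_prod_of_tube i1).integral_prod_left
    ((i4.const_mul 20).add (i3.const_mul 2)) fun y => ?_
  refine (setIntegral_mono_on ((hw.continuous.norm.pow 2).integrableOn_lift3 y)
    (integrable_const _) measurableSet_Ico (fun t ht => ?_)).trans_eq
    (by rw [integral_const, volume_real_restrict_Ico, one_smul])
  have h := norm_sub_vavg_sq_le hw hp hθ y ht
  have h1 := norm_add_le (w (lift3 y t) - vavg w y) (vavg w y)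
  rw [sub_add_cancel] at h1
  have h2 := mul_self_le_mul_self (norm_nonneg _) h1
  change ‖w (lift3 y t)‖ ^ 2 ≤ 20 * (∫ u in Set.Ico (-(1 : ℝ) / 2) (1 / 2),
    twistedSq θ w 2 (lift3 y u)) + 2 * ‖vavg w y‖ ^ 2
  nlinarith [sq_nonneg (‖w (lift3 y t) - vavg w y‖ - ‖vavg w y‖)]

theorem setIntegral_energyDensity_vavg_le {θ : Fin 3 → ℝ} {w : (Fin 3 → ℝ) → ℂ}
    (hw : ContDiff ℝ 1 w) (r : ℝ) :
    ∫ y in cell2, (outSet r).indicator (energyDensity (fun j => θ j.castSucc) (vavg w)) y ≤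
      ∫ x in cell, (low ⁻¹' outSet r).indicator
        (fun x => twistedSq θ w 0 x + twistedSq θ w 1 x) x := by
  have hm := measurableSet_outSet r
  have i1 : IntegrableOn ((low ⁻¹' outSet r).indicator
      (fun x => twistedSq θ w 0 x + twistedSq θ w 1 x)) (tube cell2) :=
    (((continuous_twistedSq hw 0).add (continuous_twistedSq hw 1)).integrableOn_tube
      (subset_refl cell2)).indicator (continuous_low.measurable hm)
  rw [cell_eq_tube, setIntegral_tube i1]
  refine integral_mono (integrableOn_cell2_indicator (continuous_energyDensity (contDiff_vavg hw))
    hm) (integrable_prod_of_tube i1).integral_prod_left fun y => ?_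
  by_cases hy : y ∈ outSet r
  · rw [Set.indicator_of_mem hy]
    refine (energyDensity_vavg_le hw y).trans_eq ?_
    refine integral_congr_ae (Filter.Eventually.of_forall fun t => ?_)
    have : lift3 y t ∈ low ⁻¹' outSet r := by rwa [Set.mem_preimage, low_lift3]
    simp only [Set.indicator_of_mem this]
  · rw [Set.indicator_of_notMem hy]
    exact integral_nonneg fun t => Set.indicator_nonneg
      (fun x _ => add_nonneg (twistedSq_nonneg _ _ _ _) (twistedSq_nonneg _ _ _ _)) _

theorem mem_fiberSet_iff {r : ℝ} (x : Fin 3 → ℝ) : x ∈ fiberSet r ↔ low x ∉ outSet r := by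
  simp only [fiberSet, outSet, Set.mem_ofPred_eq, not_forall, not_le]
  rfl

theorem measurableSet_fiberSet (r : ℝ) : MeasurableSet (fiberSet r) := by
  have : fiberSet r = (low ⁻¹' outSet r)ᶜ := by
    ext x; exact mem_fiberSet_iff x
  rw [this]
  exact (continuous_low.measurable (measurableSet_outSet r)).compl

theorem le_aForm {r ν : ℝ} (hν : 0 < ν) {a : ℝ → ℝ} (ha_meas : Measurable a)
    (ha_lb : ∀ s, ν < a s) (ha_ub : ∀ s, a s < ν⁻¹) {θ : Fin 3 → ℝ} {w : (Fin 3 → ℝ) → ℂ}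
    (hw : ContDiff ℝ 1 w) :
    min ν 1 * ((∫ x in cell, twistedSq θ w 2 x) + ∫ x in cell, (low ⁻¹' outSet r).indicator
        (fun x => twistedSq θ w 0 x + twistedSq θ w 1 x) x) ≤ aForm a r θ w := by
  have hD := continuous_twistedSq (θ := θ) hw
  have hD0 := twistedSq_nonneg θ w
  have hint : ∀ {f : (Fin 3 → ℝ) → ℝ}, Continuous f → IntegrableOn f cell := fun hf => by
    rw [cell_eq_tube]; exact hf.integrableOn_tube (subset_refl cell2)
  have hiI : IntegrableOn ((low ⁻¹' outSet r).indicator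
      (fun x => twistedSq θ w 0 x + twistedSq θ w 1 x)) cell :=
    (hint ((hD 0).add (hD 1))).indicator (continuous_low.measurable (measurableSet_outSet r))
  rw [← integral_add (hint (hD 2)) hiI, ← integral_const_mul, aForm]
  have ha0 : ∀ s, 0 ≤ a s := fun s => (hν.trans (ha_lb s)).le
  have hν' : 0 < ν⁻¹ := inv_pos.2 hν
  refine integral_mono (((hint (hD 2)).add hiI).const_mul _) ?_ fun x => ?_
  · refine Integrable.mono' (hint (f := fun x => (ν⁻¹ + 1) *
      (twistedSq θ w 0 x + twistedSq θ w 1 x + twistedSq θ w 2 x)) ?_) ?_ ?_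
    · have := hD 0
      have := hD 1
      have := hD 2
      fun_prop
    · refine (Measurable.ite (measurableSet_fiberSet r)
        ((ha_meas.comp (measurable_pi_apply 2)).mul (hD 2).measurable) ?_).aestronglyMeasurable
      exact (continuous_finsetSum _ fun j _ => hD j).measurable
    · refine Filter.Eventually.of_forall fun x => ?_
      have h0 := hD0 0 x
      have h1 := hD0 1 x
      have h2 := hD0 2 x
      split_ifs
      · change ‖a (x 2) * twistedSq θ w 2 x‖ ≤ _
        rw [Real.norm_of_nonneg (mul_nonneg (ha0 _) h2)]
        nlinarith [mul_le_mul_of_nonneg_right (ha_ub (x 2)).le h2, mul_nonneg hν'.le h0,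
          mul_nonneg hν'.le h1]
      · change ‖∑ j, twistedSq θ w j x‖ ≤ _
        rw [Fin.sum_univ_three, Real.norm_of_nonneg (by positivity)]
        nlinarith [mul_nonneg hν'.le h0, mul_nonneg hν'.le h1, mul_nonneg hν'.le h2]
  · have h0 := hD0 0 x
    have h1 := hD0 1 x
    have h2 := hD0 2 x
    by_cases hx : x ∈ fiberSet r
    · have hx' : x ∉ low ⁻¹' outSet r := (mem_fiberSet_iff x).1 hx
      simp only [if_pos hx, Set.indicator_of_notMem hx', add_zero]
      exact mul_le_mul_of_nonneg_right ((min_le_left _ _).trans (ha_lb _).le) h2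
    · have hx' : x ∈ low ⁻¹' outSet r := not_not.1 fun h => hx ((mem_fiberSet_iff x).2 h)
      simp only [if_neg hx, Set.indicator_of_mem hx', Fin.sum_univ_three]
      change _ ≤ twistedSq θ w 0 x + twistedSq θ w 1 x + twistedSq θ w 2 x
      nlinarith [min_le_right ν 1]

/-- Weak spectral gap on the complement of the degenerate subspace: there is `γ > 0` such
that `a_θ[w] ≥ γ ∫_□ |w|²` for every `θ ∈ □*` and every `C¹` periodic `w` orthogonal (with
respect to `a₀ + b₀`) to the subspace `V` of functions constant in the matrix and
independent of `y₃` in the fibre. -/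
theorem weak_spectral_gap
    (r ν : ℝ) (hr : 0 < r) (hr' : r < 1 / 2) (hν : 0 < ν)
    (a : ℝ → ℝ) (ha_meas : Measurable a) (ha_per : ∀ s, a (s + 1) = a s)
    (ha_lb : ∀ s, ν < a s) (ha_ub : ∀ s, a s < ν⁻¹) :
    ∃ γ > (0 : ℝ),
      ∀ θ ∈ dualCell,
      ∀ w : (Fin 3 → ℝ) → ℂ, ContDiff ℝ 1 w →
        (∀ (y : Fin 3 → ℝ) (m : Fin 3 → ℤ), w (y + fun i => (m i : ℝ)) = w y) →
        (∫ y in cell, w y) = 0 →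
        (∀ ζ : (Fin 2 → ℝ) → ℂ, ContDiff ℝ (⊤ : ℕ∞) ζ → HasCompactSupport ζ →
          tsupport ζ ⊆ Bset r →
          (∫ y in fiberCell r,
              (pd3 w 0 y * star (pd2 ζ 0 (low y)) + pd3 w 1 y * star (pd2 ζ 1 (low y)) +
                w y * star (ζ (low y)))) = 0) →
        γ * (∫ y in cell, ‖w y‖ ^ 2) ≤ aForm a r θ w := by
  obtain ⟨C, hC, hgap⟩ := exists_planar_gap hr hr'
  have hκ : 0 < min ν 1 := lt_min hν one_pos
  refine ⟨min ν 1 / (20 + 2 * C), by positivity, fun θ hθ w hw hp hmean hweak => ?_⟩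
  have hθ' : ∀ j, |θ j| ≤ Real.pi := fun j => abs_le.2 ⟨(hθ j trivial).1, (hθ j trivial).2.le⟩
  have hmean' : ∫ y in cell2, vavg w y = 0 := by
    rwa [cell_eq_tube, setIntegral_tube (hw.continuous.integrableOn_tube (subset_refl cell2))]
      at hmean
  have h1 := hgap (fun j => θ j.castSucc) (fun j => hθ' _) (vavg w) (contDiff_vavg hw)
    (vavg_periodic hp) hmean' fun ζ hζ hζc hζS => by
      rw [setIntegral_pairing_vavg hw hr hr' (hζ.of_le (by exact_mod_cast le_top))]
      exact hweak ζ hζ hζc hζS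
  have h2 := setIntegral_norm_sq_le_twistedSq hw hp (hθ' 2)
  have h3 := setIntegral_energyDensity_vavg_le (θ := θ) hw r
  have h4 := le_aForm (r := r) hν ha_meas ha_lb ha_ub (θ := θ) hw
  have hnn : 0 ≤ ∫ x in cell, twistedSq θ w 2 x := integral_nonneg (twistedSq_nonneg θ w 2)
  have hnn' : 0 ≤ ∫ x in cell, (low ⁻¹' outSet r).indicator
      (fun x => twistedSq θ w 0 x + twistedSq θ w 1 x) x :=
    integral_nonneg fun x => Set.indicator_nonneg
      (fun x _ => add_nonneg (twistedSq_nonneg _ _ _ _) (twistedSq_nonneg _ _ _ _)) _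
  refine le_trans ?_ h4
  rw [div_mul_eq_mul_div, div_le_iff₀ (by positivity), mul_assoc]
  refine mul_le_mul_of_nonneg_left ?_ hκ.le
  nlinarith [mul_le_mul_of_nonneg_left h3 hC.le]
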